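/- arXiv:2208.05888 — 11 statements merged into one kernel-verified Lean document; each statement's English description precedes it below -/
import Mathlib

section
/- Let T be a regularized Newton step from x ∈ dom ψ with parameter λ > 0, and suppose that ∇²f(x) ⪰ μ·Id for some μ ≥ 0 (i.e. ⟨∇²f(x)h, h⟩ ≥ μ‖h‖² for all h ∈ E). Then for every subgradient s ∈ ∂ψ(x) one has ‖T − x‖ ≤ ‖∇f(x) + s‖ / (λ + μ). -/
open Set
open scoped RealInnerProductSpace

/-- `v` is a subgradient of `ψ` at `x`. -/
def IsSubgradAt {E : Type*} [NormedAddCommGroup E] [InnerProductSpace ℝ E]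
    (ψ : E → ℝ) (v x : E) : Prop :=
  ∀ y, ψ x + ⟪v, y - x⟫ ≤ ψ y

/-- Let `T` be a regularized Newton step from `x` with parameter `λ > 0`,
i.e. `ψ'(T) := -∇f(x) - ∇²f(x)(T - x) - λ(T - x) ∈ ∂ψ(T)`, and suppose
`⟨∇²f(x)h, h⟩ ≥ μ‖h‖²` for all `h` with `μ ≥ 0`. Then for every subgradient `s ∈ ∂ψ(x)`,
`‖T - x‖ ≤ ‖∇f(x) + s‖ / (λ + μ)`. -/
theorem statement_0 {E : Type*} [NormedAddCommGroup E] [InnerProductSpace ℝ E] [CompleteSpace E]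
    (f ψ : E → ℝ) (hf : ConvexOn ℝ Set.univ f) (hψ : ConvexOn ℝ Set.univ ψ)
    (g : E → E) (hg : ∀ y, HasGradientAt f (g y) y)
    (x : E) (hessx : E →L[ℝ] E) (hhess : HasFDerivAt g hessx x)
    (lam μ : ℝ) (hlam : 0 < lam) (hμ : 0 ≤ μ)
    (hPD : ∀ h : E, μ * ‖h‖ ^ 2 ≤ ⟪hessx h, h⟫)
    (T : E) (hT : IsSubgradAt ψ (-(g x) - hessx (T - x) - lam • (T - x)) T)
    (s : E) (hs : IsSubgradAt ψ s x) :
    ‖T - x‖ ≤ ‖g x + s‖ / (lam + μ) := by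
  have h1 := hT x
  have h2 := hs T
  have h3 := hPD (T - x)
  have e : x - T = -(T - x) := by abel
  rw [e] at h1
  generalize T - x = d at *
  simp only [inner_neg_right, inner_sub_left, inner_neg_left, real_inner_smul_left,
    real_inner_self_eq_norm_sq] at h1
  have h4 : -⟪g x + s, d⟫ ≤ ‖g x + s‖ * ‖d‖ :=
    (neg_le_abs _).trans (abs_real_inner_le_norm _ _)
  rw [inner_add_left] at h4
  have h5 : (lam + μ) * ‖d‖ * ‖d‖ ≤ ‖g x + s‖ * ‖d‖ := by nlinarith
  rw [le_div_iff₀ (by linarith)]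
  rcases (norm_nonneg d).eq_or_lt with h | h
  · rw [← h, zero_mul]
    exact norm_nonneg _
  · have := le_of_mul_le_mul_right h5 h
    linarith
end

section
/- Let f : E → ℝ be three times differentiable and let γ, ν ∈ [0, 1] with 1 + ν − γ > 0. If 0 < L_{2,γ} < ∞ and 0 < L_{3,ν} < ∞, then the Hessian is Lipschitz continuous with L_{2,1} ≤ ((2 + ν)/(1 + ν)) · (L_{2,γ})^{ν/(1 + ν − γ)} · (L_{3,ν})^{(1 − γ)/(1 + ν − γ)}. In particular, for γ = 0 and ν = 1, L_{2,1} ≤ (3/2)·√(L_{2,0} L_{3,1}). -/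
open Set
open scoped ENNReal

/-- The Hölder constant `L_{p,ν}` of the `p`-th derivative of `f`:
`L_{p,ν} = sup_{x ≠ y} ‖∇^p f(x) - ∇^p f(y)‖ / ‖x - y‖^ν`, as an extended nonnegative real. -/
noncomputable def holderConst {E : Type*} [NormedAddCommGroup E] [InnerProductSpace ℝ E]
    (p : ℕ) (f : E → ℝ) (ν : ℝ) : ℝ≥0∞ :=
  ⨆ (x : E) (y : E) (_ : x ≠ y),
    ENNReal.ofReal (‖iteratedFDeriv ℝ p f x - iteratedFDeriv ℝ p f y‖ / ‖x - y‖ ^ ν)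

theorem aux_fderiv_bound {E F : Type*} [NormedAddCommGroup E] [NormedSpace ℝ E]
    [NormedAddCommGroup F] [NormedSpace ℝ F] (G : E → F) (hG : Differentiable ℝ G)
    (A B γ ν t : ℝ) (hA : 0 ≤ A) (hB : 0 ≤ B) (hν : 0 ≤ ν) (ht : 0 < t)
    (h2 : ∀ x y, x ≠ y → ‖G x - G y‖ ≤ A * ‖x - y‖ ^ γ)
    (h3 : ∀ x y, ‖fderiv ℝ G x - fderiv ℝ G y‖ ≤ B * ‖x - y‖ ^ ν) (x : E) :
    ‖fderiv ℝ G x‖ ≤ A * t ^ (γ - 1) + B * t ^ ν / (1 + ν) := by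
  have hν1 : 0 < 1 + ν := by linarith
  apply ContinuousLinearMap.opNorm_le_of_unit_norm (by positivity)
  intro h hh
  have hderiv : ∀ s : ℝ, HasDerivAt (fun s : ℝ => G (x + s • h) - G x - s • fderiv ℝ G x h)
      (fderiv ℝ G (x + s • h) h - fderiv ℝ G x h) s := by
    intro s
    have h1 : HasDerivAt (fun s : ℝ => x + s • h) h s := by
      simpa using ((hasDerivAt_id s).smul_const h).const_add x
    have h4 := (hG (x + s • h)).hasFDerivAt.comp_hasDerivAt s h1
    have h5 : HasDerivAt (fun s : ℝ => s • fderiv ℝ G x h) (fderiv ℝ G x h) s := by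
      simpa using (hasDerivAt_id s).smul_const (fderiv ℝ G x h)
    exact (h4.sub_const (G x)).sub h5
  have hBd : ∀ s : ℝ, HasDerivAt (fun s : ℝ => B / (1 + ν) * s ^ (1 + ν)) (B * s ^ ν) s := by
    intro s
    have := (Real.hasDerivAt_rpow_const (x := s) (p := 1 + ν) (Or.inr (by linarith))).const_mul
      (B / (1 + ν))
    have e : B / (1 + ν) * ((1 + ν) * s ^ (1 + ν - 1)) = B * s ^ ν := by
      rw [add_sub_cancel_left]
      field_simp
    rwa [e] at this
  have key := image_norm_le_of_norm_deriv_right_le_deriv_boundary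
    (f := fun s : ℝ => G (x + s • h) - G x - s • fderiv ℝ G x h)
    (f' := fun s : ℝ => fderiv ℝ G (x + s • h) h - fderiv ℝ G x h) (a := 0) (b := t)
    (B := fun s : ℝ => B / (1 + ν) * s ^ (1 + ν)) (B' := fun s => B * s ^ ν)
    (fun s _ => (hderiv s).continuousAt.continuousWithinAt)
    (fun s _ => (hderiv s).hasDerivWithinAt)
    (by simp [Real.zero_rpow hν1.ne']) hBd
    (by
      intro s hs
      have h6 := (fderiv ℝ G (x + s • h) - fderiv ℝ G x).le_opNorm h
      have h7 := h3 (x + s • h) x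
      rw [add_sub_cancel_left, norm_smul, hh, mul_one, Real.norm_of_nonneg hs.1] at h7
      rw [hh, mul_one] at h6
      exact h6.trans h7) (x := t) ⟨ht.le, le_rfl⟩
  have h8 : ‖G (x + t • h) - G x‖ ≤ A * t ^ γ := by
    have hne : x + t • h ≠ x := by
      intro he
      have : t • h = 0 := by simpa using he
      rcases smul_eq_zero.1 this with h0 | h0
      · exact ht.ne' h0
      · simp [h0] at hh
    have h7 := h2 _ _ hne
    rwa [add_sub_cancel_left, norm_smul, hh, mul_one, Real.norm_of_nonneg ht.le] at h7
  have h9 : ‖t • fderiv ℝ G x h‖ ≤ A * t ^ γ + B / (1 + ν) * t ^ (1 + ν) := by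
    have : t • fderiv ℝ G x h = (G (x + t • h) - G x) -
        (G (x + t • h) - G x - t • fderiv ℝ G x h) := by abel
    rw [this]
    exact (norm_sub_le _ _).trans (add_le_add h8 key)
  rw [norm_smul, Real.norm_of_nonneg ht.le] at h9
  have e1 : t ^ γ = t * t ^ (γ - 1) := by
    rw [Real.rpow_sub_one ht.ne']; field_simp
  have e2 : t ^ (1 + ν) = t * t ^ ν := by
    rw [Real.rpow_add ht, Real.rpow_one]
  rw [e1, e2] at h9
  refine le_of_mul_le_mul_left (h9.trans (le_of_eq ?_)) ht
  ring

theorem aux_opt (A B γ ν : ℝ) (hA : 0 < A) (hB : 0 < B) (hν : 0 ≤ ν) (hνγ : 0 < 1 + ν - γ) :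
    ∃ t : ℝ, 0 < t ∧ A * t ^ (γ - 1) + B * t ^ ν / (1 + ν) =
      (2 + ν) / (1 + ν) * A ^ (ν / (1 + ν - γ)) * B ^ ((1 - γ) / (1 + ν - γ)) := by
  have hν1 : 0 < 1 + ν := by linarith
  refine ⟨(A / B) ^ (1 / (1 + ν - γ)), by positivity, ?_⟩
  have e : ∀ r, ((A / B) ^ (1 / (1 + ν - γ))) ^ r =
      A ^ (r / (1 + ν - γ)) * B ^ (-(r / (1 + ν - γ))) := by
    intro r
    rw [← Real.rpow_mul (by positivity), Real.div_rpow hA.le hB.le, Real.rpow_neg hB.le,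
      div_eq_mul_inv, one_div_mul_eq_div]
  have e1 : A * A ^ ((γ - 1) / (1 + ν - γ)) = A ^ (ν / (1 + ν - γ)) := by
    nth_rewrite 1 [← Real.rpow_one A]
    rw [← Real.rpow_add hA]
    congr 1
    field_simp
    ring
  have e2 : B * B ^ (-(ν / (1 + ν - γ))) = B ^ ((1 - γ) / (1 + ν - γ)) := by
    nth_rewrite 1 [← Real.rpow_one B]
    rw [← Real.rpow_add hB]
    congr 1
    field_simp
    ring
  have e3 : -((γ - 1) / (1 + ν - γ)) = (1 - γ) / (1 + ν - γ) := by ring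
  rw [e, e, e3, ← mul_assoc, e1, mul_left_comm, e2]
  field_simp
  ring

theorem aux_holder {E : Type*} [NormedAddCommGroup E] [InnerProductSpace ℝ E]
    (p : ℕ) (f : E → ℝ) (ν : ℝ) (hfin : holderConst p f ν ≠ ⊤) (x y : E) :
    ‖iteratedFDeriv ℝ p f x - iteratedFDeriv ℝ p f y‖ ≤
      (holderConst p f ν).toReal * ‖x - y‖ ^ ν := by
  rcases eq_or_ne x y with rfl | hne
  · simp only [sub_self, norm_zero]; positivity
  · have hle : ENNReal.ofReal
        (‖iteratedFDeriv ℝ p f x - iteratedFDeriv ℝ p f y‖ / ‖x - y‖ ^ ν) ≤ holderConst p f ν :=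
      le_iSup_of_le x (le_iSup_of_le y (le_iSup_of_le hne le_rfl))
    have hpos : 0 < ‖x - y‖ ^ ν := Real.rpow_pos_of_pos (norm_pos_iff.2 (sub_ne_zero.2 hne)) _
    rw [ENNReal.ofReal_le_iff_le_toReal hfin, div_le_iff₀ hpos] at hle
    exact hle

theorem aux_main {E : Type*} [NormedAddCommGroup E] [InnerProductSpace ℝ E]
    (f : E → ℝ) (hf : ContDiff ℝ 3 f)
    (γ ν : ℝ) (hν : 0 ≤ ν) (hνγ : 0 < 1 + ν - γ)
    (h2pos : 0 < holderConst 2 f γ) (h2fin : holderConst 2 f γ ≠ ⊤)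
    (h3pos : 0 < holderConst 3 f ν) (h3fin : holderConst 3 f ν ≠ ⊤) :
    holderConst 2 f 1 ≤
        ENNReal.ofReal ((2 + ν) / (1 + ν)) * holderConst 2 f γ ^ (ν / (1 + ν - γ)) *
          holderConst 3 f ν ^ ((1 - γ) / (1 + ν - γ)) := by
  have hA : 0 < (holderConst 2 f γ).toReal := ENNReal.toReal_pos h2pos.ne' h2fin
  have hB : 0 < (holderConst 3 f ν).toReal := ENNReal.toReal_pos h3pos.ne' h3fin
  have hd : Differentiable ℝ (iteratedFDeriv ℝ 2 f) :=
    hf.differentiable_iteratedFDeriv (by norm_num)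
  obtain ⟨t, ht, hteq⟩ := aux_opt _ _ γ ν hA hB hν hνγ
  have hbd : ∀ x, ‖fderiv ℝ (iteratedFDeriv ℝ 2 f) x‖ ≤ _ := fun x =>
    (aux_fderiv_bound (iteratedFDeriv ℝ 2 f) hd _ _ γ ν t hA.le hB.le hν ht
      (fun x y _ => aux_holder 2 f γ h2fin x y)
      (fun x y => by
        have := aux_holder 3 f ν h3fin x y
        refine le_trans (le_of_eq ?_) this
        rw [fderiv_iteratedFDeriv]
        simp only [Function.comp_apply]
        rw [← dist_eq_norm, ← dist_eq_norm]
        exact LinearIsometryEquiv.dist_map _ _ _) x).trans hteq.le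
  have hfinal : holderConst 2 f 1 ≤ ENNReal.ofReal ((2 + ν) / (1 + ν) *
      (holderConst 2 f γ).toReal ^ (ν / (1 + ν - γ)) *
      (holderConst 3 f ν).toReal ^ ((1 - γ) / (1 + ν - γ))) := by
    refine iSup_le fun x => iSup_le fun y => iSup_le fun hne => ENNReal.ofReal_le_ofReal ?_
    rw [Real.rpow_one, div_le_iff₀ (norm_pos_iff.2 (sub_ne_zero.2 hne))]
    exact convex_univ.norm_image_sub_le_of_norm_fderiv_le (𝕜 := ℝ) (fun z _ => hd z)
      (fun z _ => hbd z) (mem_univ y) (mem_univ x)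
  refine hfinal.trans (le_of_eq ?_)
  rw [ENNReal.ofReal_mul (by positivity), ENNReal.ofReal_mul (by positivity),
    ← ENNReal.ofReal_rpow_of_pos hA, ← ENNReal.ofReal_rpow_of_pos hB,
    ENNReal.ofReal_toReal h2fin, ENNReal.ofReal_toReal h3fin]

/-- Let `f` be three times differentiable, `γ, ν ∈ [0,1]` with
`1 + ν - γ > 0`. If `0 < L_{2,γ} < ∞` and `0 < L_{3,ν} < ∞`, then the Hessian is Lipschitz
continuous with
`L_{2,1} ≤ ((2+ν)/(1+ν)) · L_{2,γ}^{ν/(1+ν-γ)} · L_{3,ν}^{(1-γ)/(1+ν-γ)}`.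
In particular, for `γ = 0`, `ν = 1`, `L_{2,1} ≤ (3/2)·√(L_{2,0}·L_{3,1})`. -/
theorem statement_4 {E : Type*} [NormedAddCommGroup E] [InnerProductSpace ℝ E]
    (f : E → ℝ) (hf : ContDiff ℝ 3 f)
    (γ ν : ℝ) (hγ : γ ∈ Set.Icc (0 : ℝ) 1) (hν : ν ∈ Set.Icc (0 : ℝ) 1)
    (hνγ : 0 < 1 + ν - γ)
    (h2pos : 0 < holderConst 2 f γ) (h2fin : holderConst 2 f γ ≠ ⊤)
    (h3pos : 0 < holderConst 3 f ν) (h3fin : holderConst 3 f ν ≠ ⊤) :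
    holderConst 2 f 1 ≤
        ENNReal.ofReal ((2 + ν) / (1 + ν)) * holderConst 2 f γ ^ (ν / (1 + ν - γ)) *
          holderConst 3 f ν ^ ((1 - γ) / (1 + ν - γ)) ∧
      (0 < holderConst 2 f 0 → holderConst 2 f 0 ≠ ⊤ →
        0 < holderConst 3 f 1 → holderConst 3 f 1 ≠ ⊤ →
        holderConst 2 f 1 ≤
          ENNReal.ofReal (3 / 2) * (holderConst 2 f 0 * holderConst 3 f 1) ^ ((1 : ℝ) / 2)) := by
  refine ⟨aux_main f hf γ ν hν.1 hνγ h2pos h2fin h3pos h3fin, ?_⟩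
  intro a b c d
  have h := aux_main f hf 0 1 zero_le_one (by norm_num) a b c d
  rw [ENNReal.mul_rpow_of_nonneg _ _ (by norm_num), ← mul_assoc]
  convert h using 3 <;> norm_num
end

section
/- Fix q with 2 ≤ q < 3 and suppose the Hessian of f is Hölder continuous of degree ν = q − 2 with constant M_q = L_{2,q−2} < ∞. Let x ∈ dom ψ, s ∈ ∂ψ(x), and g := ‖∇f(x) + s‖ > 0. Choose α with (q − 2)/(q − 1) ≤ α ≤ 1 and H ≥ (M_q/(q − 1))^{1/(q−1)} · (1/g)^{α − (q−2)/(q−1)}, set λ := H g^α, and let T be a regularized Newton step from x with parameter λ. Then ⟨F'(T), x − T⟩ ≥ ‖F'(T)‖² / (2λ). -/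
open Set
open scoped RealInnerProductSpace

theorem hess_nonneg_aux {E : Type*} [NormedAddCommGroup E] [InnerProductSpace ℝ E]
    [CompleteSpace E] (f : E → ℝ) (hf : ConvexOn ℝ Set.univ f)
    (g : E → E) (hg : ∀ y, HasGradientAt f (g y) y)
    (hess : E → E →L[ℝ] E) (hhess : ∀ y, HasFDerivAt g (hess y) y) (x h : E) :
    0 ≤ ⟪hess x h, h⟫ := by
  have hline : ∀ t : ℝ, HasDerivAt (fun t : ℝ => x + t • h) h t := by
    intro t
    simpa using ((hasDerivAt_id t).smul_const h).const_add x
  have h1 : ∀ t : ℝ, HasDerivAt (fun t : ℝ => f (x + t • h)) ⟪g (x + t • h), h⟫ t := by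
    intro t
    have := (hg (x + t • h)).hasFDerivAt.comp_hasDerivAt t (hline t)
    simp only [InnerProductSpace.toDual_apply_apply] at this
    exact this
  have hc : ConvexOn ℝ Set.univ (fun t : ℝ => f (x + t • h)) := by
    have := hf.comp_affineMap (AffineMap.lineMap (k := ℝ) x (x + h))
    have e : (f ∘ (AffineMap.lineMap (k := ℝ) x (x + h))) = fun t : ℝ => f (x + t • h) := by
      ext t
      simp [AffineMap.lineMap_apply, add_comm]
    rw [e] at this
    simpa using this
  have hmono : Monotone (fun t : ℝ => ⟪g (x + t • h), h⟫) := by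
    have := hc.monotoneOn_deriv (fun t _ => (h1 t).differentiableAt)
    have e : deriv (fun t : ℝ => f (x + t • h)) = fun t : ℝ => ⟪g (x + t • h), h⟫ := by
      ext t
      exact (h1 t).deriv
    rw [e] at this
    exact monotoneOn_univ.1 this
  have h2 : HasDerivAt (fun t : ℝ => g (x + t • h)) (hess x h) 0 := by
    have h3 : HasFDerivAt g (hess x) (x + (0 : ℝ) • h) := by simpa using hhess x
    exact h3.comp_hasDerivAt 0 (hline 0)
  have h4 : HasDerivAt (fun t : ℝ => ⟪g (x + t • h), h⟫) ⟪hess x h, h⟫ 0 := by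
    simpa using h2.inner ℝ (hasDerivAt_const (0 : ℝ) h)
  rw [← h4.deriv]
  exact hmono.deriv_nonneg

theorem taylor_aux {E : Type*} [NormedAddCommGroup E] [InnerProductSpace ℝ E]
    (g : E → E) (hess : E → E →L[ℝ] E) (hhess : ∀ y, HasFDerivAt g (hess y) y)
    (q M : ℝ) (hq1 : 2 ≤ q)
    (hHolder : ∀ y z : E, ‖hess y - hess z‖ ≤ M * ‖y - z‖ ^ (q - 2)) (x h : E) :
    ‖g (x + h) - g x - hess x h‖ ≤ M / (q - 1) * ‖h‖ ^ (q - 2) * ‖h‖ := by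
  have hline : ∀ t : ℝ, HasDerivAt (fun t : ℝ => x + t • h) h t := by
    intro t
    simpa using ((hasDerivAt_id t).smul_const h).const_add x
  have hG : ∀ t : ℝ, HasDerivAt (fun t : ℝ => g (x + t • h) - g x - t • hess x h)
      (hess (x + t • h) h - hess x h) t := by
    intro t
    have a := ((hhess (x + t • h)).comp_hasDerivAt t (hline t)).sub_const (g x)
    have b := (hasDerivAt_id t).smul_const (hess x h)
    have ab := a.sub b
    rw [one_smul] at ab
    exact ab
  have hB : ∀ t : ℝ, HasDerivAt (fun t : ℝ => M / (q - 1) * ‖h‖ ^ (q - 2) * ‖h‖ * t ^ (q - 1))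
      (M * ‖h‖ ^ (q - 2) * ‖h‖ * t ^ (q - 2)) t := by
    intro t
    have a := (Real.hasDerivAt_rpow_const (x := t) (p := q - 1) (Or.inr (by linarith))).const_mul
      (M / (q - 1) * ‖h‖ ^ (q - 2) * ‖h‖)
    have e : q - 1 - 1 = q - 2 := by ring
    have : q - 1 ≠ 0 := by linarith
    have e2 : M / (q - 1) * ‖h‖ ^ (q - 2) * ‖h‖ * ((q - 1) * t ^ (q - 1 - 1))
        = M * ‖h‖ ^ (q - 2) * ‖h‖ * t ^ (q - 2) := by
      rw [e]
      field_simp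
    rw [e2] at a
    exact a
  have key := image_norm_le_of_norm_deriv_right_le_deriv_boundary (a := (0 : ℝ)) (b := 1)
    (f := fun t : ℝ => g (x + t • h) - g x - t • hess x h)
    (f' := fun t : ℝ => hess (x + t • h) h - hess x h)
    (B := fun t : ℝ => M / (q - 1) * ‖h‖ ^ (q - 2) * ‖h‖ * t ^ (q - 1))
    (B' := fun t : ℝ => M * ‖h‖ ^ (q - 2) * ‖h‖ * t ^ (q - 2))
    (fun t _ => (hG t).continuousAt.continuousWithinAt)
    (fun t _ => (hG t).hasDerivWithinAt)
    (by
      have : (0 : ℝ) ^ (q - 1) = 0 := Real.zero_rpow (by linarith)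
      simp [this]) hB
    (by
      intro t ht
      have a := (hess (x + t • h) - hess x).le_opNorm h
      have b := hHolder (x + t • h) x
      have c : ‖x + t • h - x‖ ^ (q - 2) = t ^ (q - 2) * ‖h‖ ^ (q - 2) := by
        rw [add_sub_cancel_left, norm_smul, Real.norm_of_nonneg ht.1,
          Real.mul_rpow ht.1 (norm_nonneg _)]
      rw [c] at b
      have d := mul_le_mul_of_nonneg_right b (norm_nonneg h)
      simp only [_root_.sub_apply] at a
      calc _ ≤ _ := a
        _ ≤ _ := d
        _ = _ := by ring)
    (x := 1) (by simp)
  simpa using key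

/-- Fix `2 ≤ q < 3` and suppose the Hessian of the convex function `f` is
Hölder continuous of degree `q - 2` with constant `M = M_q < ∞`. Let `s ∈ ∂ψ(x)` and
`g := ‖∇f(x) + s‖ > 0`. Choose `(q-2)/(q-1) ≤ α ≤ 1` and
`H ≥ (M/(q-1))^{1/(q-1)} · (1/g)^{α - (q-2)/(q-1)}`, set `λ := H·g^α`, and let `T` be a
regularized Newton step from `x` with parameter `λ`, with
`ψ'(T) = -∇f(x) - ∇²f(x)(T-x) - λ(T-x) ∈ ∂ψ(T)` and `F'(T) = ∇f(T) + ψ'(T)`.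
Then `⟨F'(T), x - T⟩ ≥ ‖F'(T)‖² / (2λ)`. -/
theorem statement_6 {E : Type*} [NormedAddCommGroup E] [InnerProductSpace ℝ E] [CompleteSpace E]
    (f ψ : E → ℝ) (hf : ConvexOn ℝ Set.univ f) (hψ : ConvexOn ℝ Set.univ ψ)
    (g : E → E) (hg : ∀ y, HasGradientAt f (g y) y)
    (hess : E → E →L[ℝ] E) (hhess : ∀ y, HasFDerivAt g (hess y) y)
    (q M : ℝ) (hq1 : 2 ≤ q) (hq2 : q < 3) (hM : 0 ≤ M)
    (hHolder : ∀ y z : E, ‖hess y - hess z‖ ≤ M * ‖y - z‖ ^ (q - 2))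
    (x s : E) (hs : IsSubgradAt ψ s x)
    (gn : ℝ) (hgn : gn = ‖g x + s‖) (hgpos : 0 < gn)
    (α H : ℝ) (hα1 : (q - 2) / (q - 1) ≤ α) (hα2 : α ≤ 1)
    (hH : (M / (q - 1)) ^ ((1 : ℝ) / (q - 1)) * (1 / gn) ^ (α - (q - 2) / (q - 1)) ≤ H)
    (lam : ℝ) (hlam : lam = H * gn ^ α)
    (T w : E) (hw : w = -(g x) - hess x (T - x) - lam • (T - x))
    (hT : IsSubgradAt ψ w T) :
    ⟪g T + w, x - T⟫ ≥ ‖g T + w‖ ^ 2 / (2 * lam) := by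
  have hq : 0 < q - 1 := by linarith
  set c : ℝ := M / (q - 1) with hc
  have hc0 : 0 ≤ c := div_nonneg hM hq.le
  set r : ℝ := ‖T - x‖ with hr
  have hr0 : 0 ≤ r := norm_nonneg _
  -- Taylor bound
  have hD : ‖g T - g x - hess x (T - x)‖ ≤ c * r ^ (q - 2) * r := by
    have := taylor_aux g hess hhess q M hq1 hHolder x (T - x)
    rwa [add_sub_cancel] at this
  -- lower bound on lam
  have hlow : c ^ ((1 : ℝ) / (q - 1)) * gn ^ ((q - 2) / (q - 1)) ≤ lam := by
    have h1 := mul_le_mul_of_nonneg_right hH (Real.rpow_nonneg hgpos.le α)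
    rw [← hlam] at h1
    refine le_trans (le_of_eq ?_) h1
    rw [mul_assoc, one_div gn, Real.inv_rpow hgpos.le, ← Real.rpow_neg hgpos.le,
      ← Real.rpow_add hgpos]
    congr 2
    ring
  have hlow0 : 0 ≤ c ^ ((1 : ℝ) / (q - 1)) * gn ^ ((q - 2) / (q - 1)) := by positivity
  have hlam0 : 0 ≤ lam := hlow0.trans hlow
  have hpow : c * gn ^ (q - 2) ≤ lam ^ (q - 1) := by
    have h1 := Real.rpow_le_rpow hlow0 hlow hq.le
    rw [Real.mul_rpow (by positivity) (by positivity), ← Real.rpow_mul hc0,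
      ← Real.rpow_mul hgpos.le, div_mul_cancel₀ _ hq.ne', div_mul_cancel₀ _ hq.ne',
      Real.rpow_one] at h1
    exact h1
  have hF : g T + w = (g T - g x - hess x (T - x)) - lam • (T - x) := by
    rw [hw]; abel
  rcases hlam0.eq_or_lt with h0 | hpos
  · have hcz : c = 0 := by
      rw [← h0, Real.zero_rpow hq.ne'] at hpow
      have : 0 < gn ^ (q - 2) := by positivity
      nlinarith
    rw [hcz, zero_mul, zero_mul] at hD
    have : g T - g x - hess x (T - x) = 0 := norm_le_zero_iff.1 hD
    rw [hF, this, ← h0]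
    simp
  · have hrg : lam * r ≤ gn := by
      have a := hs T
      have b := hT x
      have p := hess_nonneg_aux f hf g hg hess hhess x (T - x)
      have e : x - T = -(T - x) := by abel
      rw [e, inner_neg_right] at b
      have hwi : ⟪w, T - x⟫ = -⟪g x, T - x⟫ - ⟪hess x (T - x), T - x⟫ - lam * r ^ 2 := by
        rw [hw, inner_sub_left, inner_sub_left, inner_neg_left, real_inner_smul_left,
          real_inner_self_eq_norm_sq]
      have cs := neg_le_of_abs_le (abs_real_inner_le_norm (g x + s) (T - x))
      rw [inner_add_left, ← hgn, ← hr] at cs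
      have hfin : lam * r * r ≤ gn * r := by nlinarith
      rcases hr0.eq_or_lt with hz | hrp
      · rw [← hz, mul_zero]; exact hgpos.le
      · exact le_of_mul_le_mul_right hfin hrp
    have hk : c * r ^ (q - 2) ≤ lam := by
      have h1 : lam ^ (q - 2) * r ^ (q - 2) ≤ gn ^ (q - 2) := by
        rw [← Real.mul_rpow hpos.le hr0]
        exact Real.rpow_le_rpow (by positivity) hrg (by linarith)
      have h2 : lam ^ (q - 1) = lam ^ (q - 2) * lam := by
        rw [← Real.rpow_add_one hpos.ne']; congr 1; ring
      have h3 : 0 < lam ^ (q - 2) := by positivity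
      have h4 := mul_le_mul_of_nonneg_left h1 hc0
      refine le_of_mul_le_mul_left (a := lam ^ (q - 2)) ?_ h3
      rw [← h2]
      calc _ = c * (lam ^ (q - 2) * r ^ (q - 2)) := by ring
        _ ≤ _ := h4
        _ ≤ _ := hpow
    have hD2 : ‖g T - g x - hess x (T - x)‖ ≤ lam * r :=
      hD.trans (mul_le_mul_of_nonneg_right hk hr0)
    have hDF : g T - g x - hess x (T - x) = (g T + w) + lam • (T - x) := by
      rw [hF]; abel
    rw [hDF] at hD2
    have hsq := pow_le_pow_left₀ (norm_nonneg _) hD2 2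
    rw [norm_add_sq_real, real_inner_smul_right, norm_smul, Real.norm_of_nonneg hpos.le] at hsq
    have e : x - T = -(T - x) := by abel
    rw [e, inner_neg_right, ge_iff_le, div_le_iff₀ (by positivity)]
    nlinarith
end

section
/- Let f : E → ℝ be convex and three times differentiable with third derivative Hölder continuous of degree ν ∈ [0, 1] and constant L_{3,ν} < ∞. Then for all x, h ∈ E, ‖∇³f(x)[h]²‖ ≤ 2 · (L_{3,ν}‖h‖²/(1 + ν))^{1/(1+ν)} · (⟨∇²f(x)h, h⟩)^{ν/(1+ν)}, where ∇³f(x)[h]² denotes the linear form u ↦ ∇³f(x)[h, h, u] and ‖·‖ its dual norm. -/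
open Set
open scoped RealInnerProductSpace

open Filter Topology in
lemma aux_num (g a c ν : ℝ) (ha : 0 ≤ a) (hc : 0 ≤ c) (hν : 0 ≤ ν)
    (H : ∀ τ : ℝ, 0 < τ → g * τ ≤ a + c * τ ^ (1 + ν)) :
    g ≤ 2 * c ^ ((1 : ℝ) / (1 + ν)) * a ^ (ν / (1 + ν)) := by
  have h1 : (0 : ℝ) < 1 + ν := by linarith
  have key : ∀ ε : ℝ, 0 < ε →
      g ≤ 2 * (c + ε) ^ ((1 : ℝ) / (1 + ν)) * (a + ε) ^ (ν / (1 + ν)) := by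
    intro ε hε
    have hA : 0 < a + ε := by linarith
    have hC : 0 < c + ε := by linarith
    have hp : ∀ y : ℝ, 0 < y → (y ^ ((1 : ℝ) / (1 + ν))) ^ (1 + ν) = y := by
      intro y hy
      rw [← Real.rpow_mul hy.le, one_div_mul_cancel h1.ne', Real.rpow_one]
    set p := (a + ε) ^ ((1 : ℝ) / (1 + ν)) with hpd
    set q := (c + ε) ^ ((1 : ℝ) / (1 + ν)) with hqd
    have hp0 : 0 < p := Real.rpow_pos_of_pos hA _
    have hq0 : 0 < q := Real.rpow_pos_of_pos hC _
    have h2 := H (p / q) (by positivity)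
    have h3 : (p / q) ^ (1 + ν) = (a + ε) / (c + ε) := by
      rw [Real.div_rpow hp0.le hq0.le, hp _ hA, hp _ hC]
    have h4 : (a + ε) = p * (a + ε) ^ (ν / (1 + ν)) := by
      rw [hpd, ← Real.rpow_add hA, ← add_div, div_self h1.ne', Real.rpow_one]
    have h5 : g * (p / q) ≤ 2 * (a + ε) := by
      rw [h3] at h2
      have : c * ((a + ε) / (c + ε)) ≤ (c + ε) * ((a + ε) / (c + ε)) := by
        gcongr; linarith
      rw [mul_div_cancel₀ _ hC.ne'] at this
      linarith
    rw [← mul_div_assoc, div_le_iff₀ hq0] at h5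
    have h6 : p * g ≤ p * (2 * q * (a + ε) ^ (ν / (1 + ν))) := by
      calc p * g = g * p := mul_comm _ _
        _ ≤ _ := h5
        _ = 2 * (p * (a + ε) ^ (ν / (1 + ν))) * q := by rw [← h4]
        _ = _ := by ring
    exact le_of_mul_le_mul_left h6 hp0
  have hcont : Continuous fun ε : ℝ =>
      2 * (c + ε) ^ ((1 : ℝ) / (1 + ν)) * (a + ε) ^ (ν / (1 + ν)) := by
    have e1 : 0 ≤ (1 : ℝ) / (1 + ν) := by positivity
    have e2 : 0 ≤ ν / (1 + ν) := by positivity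
    exact (continuous_const.mul ((continuous_const.add continuous_id).rpow_const
      fun _ => Or.inr e1)).mul ((continuous_const.add continuous_id).rpow_const
      fun _ => Or.inr e2)
  have ht : Tendsto (fun ε : ℝ =>
      2 * (c + ε) ^ ((1 : ℝ) / (1 + ν)) * (a + ε) ^ (ν / (1 + ν))) (𝓝[>] 0)
      (𝓝 (2 * c ^ ((1 : ℝ) / (1 + ν)) * a ^ (ν / (1 + ν)))) := by
    have := (hcont.tendsto 0).mono_left (nhdsWithin_le_nhds (s := Set.Ioi 0))
    simpa using this
  exact ge_of_tendsto ht (by filter_upwards [self_mem_nhdsWithin] with ε hε using key ε hε)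

lemma aux_line {E : Type*} [NormedAddCommGroup E] [InnerProductSpace ℝ E] (x u : E) (t : ℝ) :
    HasDerivAt (fun t : ℝ => x + t • u) u t := by
  simpa using ((hasDerivAt_id t).smul_const u).const_add x

lemma aux_nonneg {E : Type*} [NormedAddCommGroup E] [InnerProductSpace ℝ E]
    (f : E → ℝ) (hf : ConvexOn ℝ Set.univ f) (hf3 : ContDiff ℝ 3 f) (x h : E) :
    0 ≤ iteratedFDeriv ℝ 2 f x ![h, h] := by
  rw [iteratedFDeriv_two_apply]
  simp only [Matrix.cons_val_zero, Matrix.cons_val_one]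
  have d1 : Differentiable ℝ f := hf3.differentiable (by norm_num)
  have d2 : Differentiable ℝ (fderiv ℝ f) :=
    (hf3.fderiv_right (m := 1) (by norm_num)).differentiable (by norm_num)
  have hd : ∀ t : ℝ, HasDerivAt (fun t : ℝ => f (x + t • h)) (fderiv ℝ f (x + t • h) h) t :=
    fun t => (d1 _).hasFDerivAt.comp_hasDerivAt t (aux_line x h t)
  have hconv : ConvexOn ℝ Set.univ (fun t : ℝ => f (x + t • h)) := by
    refine ⟨convex_univ, fun s _ t _ a b ha hb hab => ?_⟩
    have := hf.2 (Set.mem_univ (x + s • h)) (Set.mem_univ (x + t • h)) ha hb hab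
    convert! this using 2
    have : x = (a + b) • x := by rw [hab, one_smul]
    nth_rewrite 1 [this]
    simp only [smul_eq_mul]
    module
  have hm := hconv.monotoneOn_deriv (fun t _ => (hd t).differentiableAt)
  rw [monotoneOn_univ] at hm
  have he : deriv (fun t : ℝ => f (x + t • h)) = fun t => fderiv ℝ f (x + t • h) h :=
    funext fun t => (hd t).deriv
  rw [he] at hm
  have h2 : HasDerivAt (fun t : ℝ => fderiv ℝ f (x + t • h) h)
      (fderiv ℝ (fderiv ℝ f) (x + (0:ℝ) • h) h h) 0 := by
    have := (d2 _).hasFDerivAt.comp_hasDerivAt (0:ℝ) (aux_line x h 0)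
    simpa using this.clm_apply (hasDerivAt_const (0:ℝ) h)
  have := hm.deriv_nonneg (x := 0)
  rw [h2.deriv] at this
  simpa using this

lemma aux_deriv {E : Type*} [NormedAddCommGroup E] [InnerProductSpace ℝ E]
    (f : E → ℝ) (hf3 : ContDiff ℝ 3 f) (x h u : E) (t : ℝ) :
    HasDerivAt (fun t : ℝ => iteratedFDeriv ℝ 2 f (x + t • u) ![h, h])
      (iteratedFDeriv ℝ 3 f (x + t • u) ![u, h, h]) t := by
  have d3 : Differentiable ℝ (iteratedFDeriv ℝ 2 f) :=
    hf3.differentiable_iteratedFDeriv (by norm_num)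
  have h1 : DifferentiableAt ℝ (fun y => iteratedFDeriv ℝ 2 f y ![h, h]) (x + t • u) :=
    (d3 _).continuousMultilinear_apply_const _
  have := h1.hasFDerivAt.comp_hasDerivAt t (aux_line x u t)
  rw [(d3 _).iteratedFDeriv_succ_apply_left']
  exact this

lemma aux_symm {E : Type*} [NormedAddCommGroup E] [InnerProductSpace ℝ E]
    (f : E → ℝ) (hf3 : ContDiff ℝ 3 f) (x h u : E) :
    iteratedFDeriv ℝ 3 f x ![h, h, u] = iteratedFDeriv ℝ 3 f x ![u, h, h] := by
  have d3 : Differentiable ℝ (iteratedFDeriv ℝ 2 f) :=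
    hf3.differentiable_iteratedFDeriv (by norm_num)
  have s1 : iteratedFDeriv ℝ 3 f x ![h, h, u] = iteratedFDeriv ℝ 3 f x ![h, u, h] := by
    rw [(d3 _).iteratedFDeriv_succ_apply_left', (d3 _).iteratedFDeriv_succ_apply_left']
    have : (fun y => iteratedFDeriv ℝ 2 f y (Fin.tail ![h, h, u])) =
        fun y => iteratedFDeriv ℝ 2 f y (Fin.tail ![h, u, h]) := by
      funext y
      rw [iteratedFDeriv_two_apply, iteratedFDeriv_two_apply]
      have hs : IsSymmSndFDerivAt ℝ f y :=
        hf3.contDiffAt.isSymmSndFDerivAt (by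
          rw [minSmoothness_of_isRCLikeNormedField]; norm_num)
      exact hs h u
    rw [this]
    rfl
  have s2 : iteratedFDeriv ℝ 3 f x ![h, u, h] = iteratedFDeriv ℝ 3 f x ![u, h, h] := by
    rw [iteratedFDeriv_succ_apply_right, iteratedFDeriv_two_apply,
      iteratedFDeriv_succ_apply_right (n := 2) ![u, h, h], iteratedFDeriv_two_apply]
    have hs : IsSymmSndFDerivAt ℝ (fderiv ℝ f) x :=
      (hf3.fderiv_right (m := 2) (by norm_num)).contDiffAt.isSymmSndFDerivAt (by
          rw [minSmoothness_of_isRCLikeNormedField])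
    exact congrArg (fun l : E →L[ℝ] ℝ => l h) (hs h u)
  rw [s1, s2]

lemma aux_taylor {E : Type*} [NormedAddCommGroup E] [InnerProductSpace ℝ E]
    (f : E → ℝ) (hf : ConvexOn ℝ Set.univ f) (hf3 : ContDiff ℝ 3 f)
    (ν L : ℝ) (hν : 0 ≤ ν)
    (hHolder : ∀ x y : E,
      ‖iteratedFDeriv ℝ 3 f x - iteratedFDeriv ℝ 3 f y‖ ≤ L * ‖x - y‖ ^ ν)
    (x h u : E) (t : ℝ) (ht : 0 ≤ t) :
    -(iteratedFDeriv ℝ 3 f x ![u, h, h]) * t ≤ iteratedFDeriv ℝ 2 f x ![h, h] +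
      L * ‖h‖ ^ 2 / (1 + ν) * (t * ‖u‖) ^ (1 + ν) := by
  have h1 : (0 : ℝ) < 1 + ν := by linarith
  set K := L * ‖h‖ ^ 2 / (1 + ν) with hK
  have hd : ∀ s : ℝ, HasDerivAt (fun s : ℝ => iteratedFDeriv ℝ 2 f (x + s • u) ![h, h]
      - s * iteratedFDeriv ℝ 3 f x ![u, h, h] - K * (s * ‖u‖) ^ (1 + ν))
      (iteratedFDeriv ℝ 3 f (x + s • u) ![u, h, h] - 1 * iteratedFDeriv ℝ 3 f x ![u, h, h]
        - K * ((1 * ‖u‖) * (1 + ν) * (s * ‖u‖) ^ (1 + ν - 1))) s := fun s =>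
    ((aux_deriv f hf3 x h u s).sub ((hasDerivAt_id s).mul_const _)).sub
      ((((hasDerivAt_id s).mul_const ‖u‖).rpow_const (Or.inr (by linarith))).const_mul K)
  have hanti := antitoneOn_of_deriv_nonpos (convex_Ici (0:ℝ))
    (fun s _ => (hd s).continuousAt.continuousWithinAt)
    (fun s _ => (hd s).differentiableAt.differentiableWithinAt) (by
      intro s hs
      rw [interior_Ici, Set.mem_Ioi] at hs
      rw [(hd s).deriv]
      have b := hHolder (x + s • u) x
      rw [add_sub_cancel_left, norm_smul, Real.norm_of_nonneg hs.le] at b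
      have b2 := (iteratedFDeriv ℝ 3 f (x + s • u) - iteratedFDeriv ℝ 3 f x).le_of_opNorm_le
         b ![u, h, h]
      rw [Fin.prod_univ_three] at b2
      simp only [Matrix.cons_val_zero, Matrix.cons_val_one,
        Matrix.cons_val, sub_apply] at b2
      have b3 := (le_abs_self _).trans b2
      have : K * ((1 * ‖u‖) * (1 + ν) * (s * ‖u‖) ^ (1 + ν - 1)) =
          L * (s * ‖u‖) ^ ν * (‖u‖ * ‖h‖ * ‖h‖) := by
        rw [hK, add_sub_cancel_left]; field_simp
      rw [this]
      linarith)
  have h2 := hanti (Set.mem_Ici.2 le_rfl) (Set.mem_Ici.2 ht) ht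
  have h3 := aux_nonneg f hf hf3 (x + t • u) h
  simp only [zero_smul, add_zero, zero_mul, sub_zero, Real.zero_rpow h1.ne', mul_zero] at h2
  linarith

/-- Let `f` be convex and three times differentiable with third derivative
Hölder continuous of degree `ν ∈ [0,1]` and constant `L_{3,ν} = L < ∞`. Then for all
`x, h`, `‖∇³f(x)[h]²‖ ≤ 2·(L‖h‖²/(1+ν))^{1/(1+ν)} · (⟨∇²f(x)h, h⟩)^{ν/(1+ν)}`, where
`∇³f(x)[h]²` is the linear form `u ↦ ∇³f(x)[h,h,u]` with its dual (operator) norm. -/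
theorem statement_7 {E : Type*} [NormedAddCommGroup E] [InnerProductSpace ℝ E]
    (f : E → ℝ) (hf : ConvexOn ℝ Set.univ f) (hf3 : ContDiff ℝ 3 f)
    (ν L : ℝ) (hν : ν ∈ Set.Icc (0 : ℝ) 1) (hL : 0 ≤ L)
    (hHolder : ∀ x y : E,
      ‖iteratedFDeriv ℝ 3 f x - iteratedFDeriv ℝ 3 f y‖ ≤ L * ‖x - y‖ ^ ν)
    (x h : E) :
    ‖(iteratedFDeriv ℝ 3 f x).toContinuousLinearMap (fun _ => h) 2‖ ≤
      2 * (L * ‖h‖ ^ 2 / (1 + ν)) ^ ((1 : ℝ) / (1 + ν)) *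
        (iteratedFDeriv ℝ 2 f x ![h, h]) ^ (ν / (1 + ν)) := by
  have hν0 := hν.1
  have h1 : (0 : ℝ) < 1 + ν := by linarith
  have ha := aux_nonneg f hf hf3 x h
  have hc : 0 ≤ L * ‖h‖ ^ 2 / (1 + ν) := by positivity
  have hM : 0 ≤ 2 * (L * ‖h‖ ^ 2 / (1 + ν)) ^ ((1 : ℝ) / (1 + ν)) *
        (iteratedFDeriv ℝ 2 f x ![h, h]) ^ (ν / (1 + ν)) :=
    mul_nonneg (mul_nonneg zero_le_two (Real.rpow_nonneg hc _)) (Real.rpow_nonneg ha _)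
  have happ : ∀ u, (iteratedFDeriv ℝ 3 f x).toContinuousLinearMap (fun _ => h) 2 u =
      iteratedFDeriv ℝ 3 f x ![u, h, h] := by
    intro u
    rw [← aux_symm f hf3 x h u]
    change iteratedFDeriv ℝ 3 f x (Function.update (fun _ => h) 2 u) = _
    congr 1
    funext i
    fin_cases i <;> simp [Function.update]
  have hone : ∀ u : E, -((iteratedFDeriv ℝ 3 f x).toContinuousLinearMap (fun _ => h) 2 u) ≤
      2 * (L * ‖h‖ ^ 2 / (1 + ν)) ^ ((1 : ℝ) / (1 + ν)) *
        (iteratedFDeriv ℝ 2 f x ![h, h]) ^ (ν / (1 + ν)) * ‖u‖ := by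
    intro u
    rcases eq_or_ne u 0 with rfl | hu
    · rw [map_zero, norm_zero, mul_zero, neg_zero]
    have hu0 : 0 < ‖u‖ := norm_pos_iff.2 hu
    rw [← div_le_iff₀ hu0]
    refine aux_num _ _ _ _ ha hc hν0 fun s hs => ?_
    have := aux_taylor f hf hf3 ν L hν0 hHolder x h u (s / ‖u‖) (by positivity)
    rw [div_mul_cancel₀ _ hu0.ne'] at this
    rw [happ]
    calc _ = -(iteratedFDeriv ℝ 3 f x ![u, h, h]) * (s / ‖u‖) := by ring
      _ ≤ _ := this
  refine ContinuousLinearMap.opNorm_le_bound _ hM fun u => ?_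
  rw [Real.norm_eq_abs, abs_le]
  constructor
  · linarith [hone u]
  · have := hone (-u)
    rwa [map_neg, neg_neg, norm_neg] at this
end

section
/- Fix q ∈ [2, 4] and suppose M_q < ∞ (i.e. the Hessian is Hölder continuous of degree q − 2 with constant M_q if q < 3, and the third derivative is Hölder continuous of degree q − 3 with constant M_q if q ≥ 3). Let x ∈ dom ψ, s ∈ ∂ψ(x), g := ‖∇f(x) + s‖ > 0, choose α with (q − 2)/(q − 1) ≤ α ≤ 1 and H ≥ (6 M_q)^{1/(q−1)} · (1/g)^{α − (q−2)/(q−1)}, set λ := H g^α, and let T be a regularized Newton step from x with parameter λ. Then ⟨F'(T), x − T⟩ ≥ ‖F'(T)‖² / (4λ). -/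
open Set
open scoped RealInnerProductSpace

lemma hess_psd {E : Type*} [NormedAddCommGroup E] [InnerProductSpace ℝ E] [CompleteSpace E]
    (f : E → ℝ) (hf : ConvexOn ℝ Set.univ f)
    (g : E → E) (hg : ∀ y, HasGradientAt f (g y) y)
    (hess : E → E →L[ℝ] E) (hhess : ∀ y, HasFDerivAt g (hess y) y) (y h : E) :
    0 ≤ ⟪hess y h, h⟫ := by
  have hline : ∀ t : ℝ, HasDerivAt (fun t : ℝ => y + t • h) h t := fun t => by
    simpa using ((hasDerivAt_id t).smul_const h).const_add y
  have h1 : ∀ t : ℝ, HasDerivAt (fun t : ℝ => f (y + t • h)) ⟪g (y + t • h), h⟫ t := fun t => by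
    have := (hg (y + t • h)).hasFDerivAt.comp_hasDerivAt t (hline t)
    simpa [Function.comp_def] using this
  have h2 : HasDerivAt (fun t : ℝ => ⟪g (y + t • h), h⟫) ⟪hess y h, h⟫ 0 := by
    have h0 : HasFDerivAt g (hess y) (y + (0:ℝ) • h) := by simpa using hhess y
    have := (h0.comp_hasDerivAt (0:ℝ) (hline 0)).inner ℝ (hasDerivAt_const (0:ℝ) h)
    simpa using this
  have hc : ConvexOn ℝ Set.univ (fun t : ℝ => f (y + t • h)) := by
    refine ⟨convex_univ, fun a _ b _ c d hc hd hcd => ?_⟩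
    have := hf.2 (mem_univ (y + a • h)) (mem_univ (y + b • h)) hc hd hcd
    convert this using 2
    have : y = (c + d) • y := by rw [hcd, one_smul]
    nth_rw 1 [this]
    simp only [smul_eq_mul, smul_add, add_smul, mul_smul]
    abel
  have hm : Monotone (fun t : ℝ => ⟪g (y + t • h), h⟫) := by
    have := hc.monotoneOn_deriv (fun t _ => (h1 t).differentiableAt)
    have e : deriv (fun t : ℝ => f (y + t • h)) = (fun t : ℝ => ⟪g (y + t • h), h⟫) :=
      funext fun t => (h1 t).deriv
    rw [e] at this
    exact monotoneOn_univ.1 this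
  have := (hm.monotoneOn Set.univ).derivWithin_nonneg (x := 0)
  rwa [derivWithin_univ, h2.deriv] at this

lemma delta2 {E : Type*} [NormedAddCommGroup E] [InnerProductSpace ℝ E] [CompleteSpace E]
    (g : E → E) (hess : E → E →L[ℝ] E) (hhess : ∀ y, HasFDerivAt g (hess y) y)
    (x h v : E) :
    ∃ ξ ∈ Ioo (0:ℝ) 1, ⟪g (x + h) - g x - hess x h, v⟫
      = ⟪hess (x + ξ • h) h, v⟫ - ⟪hess x h, v⟫ := by
  have hline : ∀ t : ℝ, HasDerivAt (fun t : ℝ => x + t • h) h t := fun t => by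
    simpa using ((hasDerivAt_id t).smul_const h).const_add x
  have h2 : ∀ t : ℝ, HasDerivAt (fun t : ℝ => ⟪g (x + t • h), v⟫ - t * ⟪hess x h, v⟫)
      (⟪hess (x + t • h) h, v⟫ - ⟪hess x h, v⟫) t := fun t => by
    have h3 := ((hhess _).comp_hasDerivAt t (hline t)).inner ℝ (hasDerivAt_const t v)
    have h4 := (hasDerivAt_id t).mul_const ⟪hess x h, v⟫
    simpa using h3.fun_sub h4
  obtain ⟨ξ, hξ, e⟩ := exists_hasDerivAt_eq_slope _ _ (zero_lt_one' ℝ)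
    (fun t _ => (h2 t).continuousAt.continuousWithinAt) (fun t _ => h2 t)
  refine ⟨ξ, hξ, ?_⟩
  rw [e]
  simp [inner_sub_left]
  ring

lemma hess_deriv {E : Type*} [NormedAddCommGroup E] [InnerProductSpace ℝ E] [CompleteSpace E]
    (f : E → ℝ) (g : E → E) (hg : ∀ y, HasGradientAt f (g y) y)
    (hess : E → E →L[ℝ] E) (hhess : ∀ y, HasFDerivAt g (hess y) y)
    (hc : ContDiff ℝ 3 f) (y v a b : E) (t : ℝ) :
    HasDerivAt (fun t : ℝ => ⟪hess (y + t • v) a, b⟫)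
      (iteratedFDeriv ℝ 3 f (y + t • v) ![v, a, b]) t := by
  have hline : ∀ t : ℝ, HasDerivAt (fun t : ℝ => y + t • v) v t := fun t => by
    simpa using ((hasDerivAt_id t).smul_const v).const_add y
  have e1 : fderiv ℝ f = fun y => InnerProductSpace.toDual ℝ E (g y) :=
    funext fun y => (hg y).hasFDerivAt.fderiv
  have e2 : ∀ z, iteratedFDeriv ℝ 2 f z ![a, b] = ⟪hess z a, b⟫ := fun z => by
    rw [iteratedFDeriv_two_apply, e1]
    have := ((InnerProductSpace.toDual ℝ E).toContinuousLinearEquiv.toContinuousLinearMap.hasFDerivAt (x := g z)).comp z (hhess z)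
    have h' : HasFDerivAt (fun y => InnerProductSpace.toDual ℝ E (g y)) _ z := this
    rw [h'.fderiv]
    simp
  have hd : Differentiable ℝ (iteratedFDeriv ℝ 2 f) :=
    hc.differentiable_iteratedFDeriv (by norm_cast)
  have h3 := ((hd (y + t • v)).hasFDerivAt.comp_hasDerivAt t (hline t))
  have h4 := ((ContinuousMultilinearMap.apply ℝ (fun _ : Fin 2 => E) ℝ ![a, b]).hasFDerivAt).comp_hasDerivAt t h3
  have h5 : HasDerivAt (fun t : ℝ => iteratedFDeriv ℝ 2 f (y + t • v) ![a, b])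
    (iteratedFDeriv ℝ 3 f (y + t • v) ![v, a, b]) t := by
    rw [iteratedFDeriv_succ_apply_left]
    exact h4
  simpa only [e2] using h5

lemma hess_symm {E : Type*} [NormedAddCommGroup E] [InnerProductSpace ℝ E] [CompleteSpace E]
    (f : E → ℝ) (g : E → E) (hg : ∀ y, HasGradientAt f (g y) y)
    (hess : E → E →L[ℝ] E) (hhess : ∀ y, HasFDerivAt g (hess y) y) (z a b : E) :
    ⟪hess z a, b⟫ = ⟪hess z b, a⟫ := by
  have h' : HasFDerivAt (fun y => InnerProductSpace.toDual ℝ E (g y)) _ z :=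
    ((InnerProductSpace.toDual ℝ E).toContinuousLinearEquiv.toContinuousLinearMap.hasFDerivAt
      (x := g z)).comp z (hhess z)
  have := second_derivative_symmetric (fun y => (hg y).hasFDerivAt) h' a b
  simpa using this

lemma D3_swap23 {E : Type*} [NormedAddCommGroup E] [InnerProductSpace ℝ E] [CompleteSpace E]
    (f : E → ℝ) (g : E → E) (hg : ∀ y, HasGradientAt f (g y) y)
    (hess : E → E →L[ℝ] E) (hhess : ∀ y, HasFDerivAt g (hess y) y)
    (hc : ContDiff ℝ 3 f) (y v a b : E) :
    iteratedFDeriv ℝ 3 f y ![v, a, b] = iteratedFDeriv ℝ 3 f y ![v, b, a] := by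
  have h1 := hess_deriv f g hg hess hhess hc y v a b 0
  have h2 := hess_deriv f g hg hess hhess hc y v b a 0
  simp only [hess_symm f g hg hess hhess _ b a] at h2
  simpa using h1.unique h2

set_option maxHeartbeats 1000000 in
lemma D3_swap12 {E : Type*} [NormedAddCommGroup E] [InnerProductSpace ℝ E] [CompleteSpace E]
    (f : E → ℝ) (g : E → E) (hg : ∀ y, HasGradientAt f (g y) y)
    (hess : E → E →L[ℝ] E) (hhess : ∀ y, HasFDerivAt g (hess y) y)
    (hc : ContDiff ℝ 3 f) (y v a b : E) :
    iteratedFDeriv ℝ 3 f y ![v, a, b] = iteratedFDeriv ℝ 3 f y ![a, v, b] := by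
  have e1 : (fun z => ⟪g z, b⟫) = fun z => fderiv ℝ f z b := by
    funext z
    rw [(hg z).hasFDerivAt.fderiv]
    simp
  have c2 : ContDiff ℝ 2 (fun z => ⟪g z, b⟫) := by
    rw [e1]
    exact (hc.fderiv_right (m := 2) (by norm_num)).clm_apply contDiff_const
  have hu : ∀ z d, fderiv ℝ (fun z => ⟪g z, b⟫) z d = ⟪hess z d, b⟫ := fun z d => by
    rw [((hhess z).inner ℝ (hasFDerivAt_const b z)).fderiv]
    simp
  have sy : IsSymmSndFDerivAt ℝ (fun z => ⟪g z, b⟫) y :=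
    c2.contDiffAt.isSymmSndFDerivAt (by simp)
  have hdd : Differentiable ℝ (fderiv ℝ (fun z => ⟪g z, b⟫)) :=
    (c2.fderiv_right (m := 1) (by norm_num)).differentiable (by norm_num)
  have key : ∀ v a, fderiv ℝ (fderiv ℝ (fun z => ⟪g z, b⟫)) y v a
      = iteratedFDeriv ℝ 3 f y ![v, a, b] := fun v a => by
    have hline : HasDerivAt (fun t : ℝ => y + t • v) v 0 := by
      simpa using ((hasDerivAt_id (0:ℝ)).smul_const v).const_add y
    have h0 : HasFDerivAt (fderiv ℝ (fun z => ⟪g z, b⟫))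
        (fderiv ℝ (fderiv ℝ (fun z => ⟪g z, b⟫)) y) (y + (0:ℝ) • v) := by
      simpa using (hdd y).hasFDerivAt
    have h1 := (h0.comp_hasDerivAt (0:ℝ) hline).clm_apply (hasDerivAt_const (0:ℝ) a)
    simp only [Function.comp_apply, hu] at h1
    have h2 := hess_deriv f g hg hess hhess hc y v a b 0
    simpa using h1.unique h2
  rw [← key, ← key]
  exact sy v a

lemma delta3 {E : Type*} [NormedAddCommGroup E] [InnerProductSpace ℝ E] [CompleteSpace E]
    (f : E → ℝ) (hf : ConvexOn ℝ Set.univ f)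
    (g : E → E) (hg : ∀ y, HasGradientAt f (g y) y)
    (hess : E → E →L[ℝ] E) (hhess : ∀ y, HasFDerivAt g (hess y) y)
    (p M : ℝ) (hp : 0 ≤ p) (hM : 0 ≤ M) (hc : ContDiff ℝ 3 f)
    (hH : ∀ y z : E, ‖iteratedFDeriv ℝ 3 f y - iteratedFDeriv ℝ 3 f z‖ ≤ M * ‖y - z‖ ^ p)
    (x h : E) (τ : ℝ) (hτ : 0 < τ) :
    τ * ‖g (x + h) - g x - hess x h‖ ≤
      ⟪hess x h, h⟫ + τ * (M * τ ^ p * ‖h‖ ^ 2) + τ * (M * ‖h‖ ^ p * ‖h‖ ^ 2) := by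
  set Δ := g (x + h) - g x - hess x h with hΔ
  have psd := hess_psd f hf g hg hess hhess
  by_cases h0 : Δ = 0
  · rw [h0, norm_zero, mul_zero]
    have := psd x h
    positivity
  have hn : 0 < ‖Δ‖ := norm_pos_iff.2 h0
  obtain ⟨v, hv1, hv2⟩ : ∃ v : E, ‖v‖ = 1 ∧ ⟪Δ, v⟫ = ‖Δ‖ := by
    refine ⟨‖Δ‖⁻¹ • Δ, ?_, ?_⟩
    · rw [norm_smul, norm_inv, norm_norm, inv_mul_cancel₀ hn.ne']
    · rw [inner_smul_right, real_inner_self_eq_norm_sq]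
      field_simp
  have hD := hess_deriv f g hg hess hhess hc
  have holder : ∀ (y z a b c : E), |iteratedFDeriv ℝ 3 f y ![a, b, c] - iteratedFDeriv ℝ 3 f z ![a, b, c]|
      ≤ M * ‖y - z‖ ^ p * (‖a‖ * ‖b‖ * ‖c‖) := fun y z a b c => by
    have := (iteratedFDeriv ℝ 3 f y - iteratedFDeriv ℝ 3 f z).le_opNorm ![a, b, c]
    simp only [Fin.prod_univ_three] at this
    refine le_trans this ?_
    exact mul_le_mul_of_nonneg_right (hH y z) (by positivity)
  have sym : iteratedFDeriv ℝ 3 f x ![v, h, h] = iteratedFDeriv ℝ 3 f x ![h, h, v] := by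
    rw [D3_swap12 f g hg hess hhess hc, D3_swap23 f g hg hess hhess hc]
  obtain ⟨ξ, hξ, e1⟩ := delta2 g hess hhess x h v
  obtain ⟨η, hη, e2⟩ := exists_hasDerivAt_eq_slope (fun t : ℝ => ⟪hess (x + t • h) h, v⟫) _ hξ.1
    (fun t _ => (hD x h h v t).continuousAt.continuousWithinAt) (fun t _ => hD x h h v t)
  obtain ⟨ζ, hζ, e3⟩ := exists_hasDerivAt_eq_slope (fun t : ℝ => ⟪hess (x + t • v) h, h⟫) _
    (neg_lt_zero.2 hτ)
    (fun t _ => (hD x v h h t).continuousAt.continuousWithinAt) (fun t _ => hD x v h h t)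
  rw [← hΔ, hv2] at e1
  have b1 := holder (x + η • h) x h h v
  have b2 := holder (x + ζ • v) x v h h
  rw [eq_div_iff (by linarith [hξ.1])] at e2
  rw [eq_div_iff (by linarith)] at e3
  simp only [add_sub_cancel_left, norm_smul, Real.norm_eq_abs, hv1, mul_one, one_mul, zero_smul, add_zero, sub_zero] at b1 b2 e2 e3
  have p1 : (|η| * ‖h‖) ^ p ≤ ‖h‖ ^ p := by
    apply Real.rpow_le_rpow (by positivity) _ hp
    have : |η| ≤ 1 := by rw [abs_of_pos hη.1]; linarith [hη.2, hξ.2]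
    nlinarith [norm_nonneg h]
  have p2 : |ζ| ^ p ≤ τ ^ p := by
    apply Real.rpow_le_rpow (by positivity) _ hp
    rw [abs_of_neg hζ.2]; linarith [hζ.1]
  have c1 : M * (|η| * ‖h‖) ^ p * (‖h‖ * ‖h‖) ≤ M * ‖h‖ ^ p * ‖h‖ ^ 2 := by
    rw [pow_two]; gcongr
  have c2 : M * |ζ| ^ p * (‖h‖ * ‖h‖) ≤ M * τ ^ p * ‖h‖ ^ 2 := by
    rw [pow_two]; gcongr
  have b1' := (abs_le.1 (b1.trans c1)).2
  have b2' := (abs_le.1 (b2.trans c2)).1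
  rw [sym] at b2'
  have q1 := psd (x + (-τ) • v) h
  set A := iteratedFDeriv ℝ 3 f (x + η • h) ![h, h, v]
  set B := iteratedFDeriv ℝ 3 f (x + ζ • v) ![v, h, h]
  set C := iteratedFDeriv ℝ 3 f x ![h, h, v]
  have n1 : ‖Δ‖ = A * ξ := by rw [e1, e2]
  have n2 : ‖Δ‖ ≤ A := by
    have hA : 0 < A := by
      by_contra hA
      nlinarith [hξ.1]
    nlinarith [hξ.2]
  have n3 : B * τ ≤ ⟪hess x h, h⟫ := by
    have : B * τ = B * (0 - -τ) := by ring
    linarith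
  nlinarith

/-- Fix `q ∈ [2,4]` and suppose `M_q = M < ∞`: the Hessian of the convex
function `f` is Hölder continuous of degree `q - 2` with constant `M` if `q < 3`, and the
third derivative is Hölder continuous of degree `q - 3` with constant `M` if `q ≥ 3`.
Let `s ∈ ∂ψ(x)`, `g := ‖∇f(x) + s‖ > 0`, choose `(q-2)/(q-1) ≤ α ≤ 1` and
`H ≥ (6M)^{1/(q-1)} · (1/g)^{α - (q-2)/(q-1)}`, set `λ := H·g^α`, and let `T` be a
regularized Newton step from `x` with parameter `λ`, with
`ψ'(T) = -∇f(x) - ∇²f(x)(T-x) - λ(T-x) ∈ ∂ψ(T)` and `F'(T) = ∇f(T) + ψ'(T)`.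
Then `⟨F'(T), x - T⟩ ≥ ‖F'(T)‖² / (4λ)`. -/
theorem statement_10 {E : Type*} [NormedAddCommGroup E] [InnerProductSpace ℝ E] [CompleteSpace E]
    (f ψ : E → ℝ) (hf : ConvexOn ℝ Set.univ f) (hψ : ConvexOn ℝ Set.univ ψ)
    (g : E → E) (hg : ∀ y, HasGradientAt f (g y) y)
    (hess : E → E →L[ℝ] E) (hhess : ∀ y, HasFDerivAt g (hess y) y)
    (q M : ℝ) (hq1 : 2 ≤ q) (hq2 : q ≤ 4) (hM : 0 ≤ M)
    (hHolder2 : q < 3 → ∀ y z : E, ‖hess y - hess z‖ ≤ M * ‖y - z‖ ^ (q - 2))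
    (hHolder3 : 3 ≤ q → ContDiff ℝ 3 f ∧ ∀ y z : E,
      ‖iteratedFDeriv ℝ 3 f y - iteratedFDeriv ℝ 3 f z‖ ≤ M * ‖y - z‖ ^ (q - 3))
    (x s : E) (hs : IsSubgradAt ψ s x)
    (gn : ℝ) (hgn : gn = ‖g x + s‖) (hgpos : 0 < gn)
    (α H : ℝ) (hα1 : (q - 2) / (q - 1) ≤ α) (hα2 : α ≤ 1)
    (hH : (6 * M) ^ ((1 : ℝ) / (q - 1)) * (1 / gn) ^ (α - (q - 2) / (q - 1)) ≤ H)
    (lam : ℝ) (hlam : lam = H * gn ^ α)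
    (T w : E) (hw : w = -(g x) - hess x (T - x) - lam • (T - x))
    (hT : IsSubgradAt ψ w T) :
    ⟪g T + w, x - T⟫ ≥ ‖g T + w‖ ^ 2 / (4 * lam) := by
  subst hgn
  have hq : (0:ℝ) < q - 1 := by linarith
  have hHn : 0 ≤ H := le_trans (by positivity) hH
  have hlam0 : 0 ≤ lam := by rw [hlam]; positivity
  set G := ‖g x + s‖ with hG
  have hpow : 6 * M * G ^ (q - 2) ≤ lam ^ (q - 1) := by
    have h1 : (6 * M) ^ ((1 : ℝ) / (q - 1)) * G ^ ((q - 2) / (q - 1)) ≤ lam := by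
      have h2 := mul_le_mul_of_nonneg_right hH (Real.rpow_nonneg hgpos.le α)
      rw [← hlam] at h2
      refine le_trans (le_of_eq ?_) h2
      rw [mul_assoc, one_div G, Real.inv_rpow hgpos.le, ← Real.rpow_neg hgpos.le,
        ← Real.rpow_add hgpos]
      congr 2
      ring
    have h2 := Real.rpow_le_rpow (by positivity) h1 hq.le
    rw [Real.mul_rpow (by positivity) (by positivity), ← Real.rpow_mul (by positivity),
      ← Real.rpow_mul (by positivity), div_mul_cancel₀ _ hq.ne', div_mul_cancel₀ _ hq.ne',
      Real.rpow_one] at h2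
    exact h2
  obtain ⟨h, rfl⟩ : ∃ h, T = x + h := ⟨T - x, by abel⟩
  have ex : x - (x + h) = -h := by abel
  rw [ex]
  rw [add_sub_cancel_left] at hw
  set Δ := g (x + h) - g x - hess x h with hΔ
  have eF : g (x + h) + w = Δ - lam • h := by rw [hw, hΔ]; abel
  rw [eF]
  set φ := ⟪hess x h, h⟫ with hφ
  have hφ0 : 0 ≤ φ := hess_psd f hf g hg hess hhess x h
  have hmono : φ + lam * ‖h‖ ^ 2 ≤ G * ‖h‖ := by
    have a1 := hs (x + h)
    have a2 := hT x
    rw [ex, inner_neg_right] at a2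
    rw [add_sub_cancel_left] at a1
    have a3 : ⟪w, h⟫ = -⟪g x, h⟫ - φ - lam * ‖h‖ ^ 2 := by
      rw [hw, inner_sub_left, inner_sub_left, inner_neg_left, real_inner_smul_left,
        real_inner_self_eq_norm_sq]
    have a4 : -(G * ‖h‖) ≤ ⟪g x + s, h⟫ := (abs_le.1 (abs_real_inner_le_norm _ _)).1
    rw [inner_add_left] at a4
    linarith
  have key : ‖Δ‖ ≤ lam * ‖h‖ := by
    have hr := norm_nonneg h
    rcases hlam0.eq_or_lt with hl | hl
    · have hM0 : M = 0 := by
        rw [← hl, Real.zero_rpow hq.ne'] at hpow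
        have : 0 < G ^ (q - 2) := by positivity
        nlinarith
      rw [← hl, zero_mul]
      rcases lt_or_ge q 3 with h3 | h3
      · obtain ⟨ξ, hξ, e⟩ := delta2 g hess hhess x h Δ
        have := hHolder2 h3 (x + ξ • h) x
        rw [hM0, zero_mul] at this
        have h0 := sub_eq_zero.1 (norm_le_zero_iff.1 this)
        rw [h0, sub_self, ← hΔ, real_inner_self_eq_norm_sq] at e
        exact (pow_eq_zero_iff two_ne_zero |>.1 e).le
      · obtain ⟨hc, hH3⟩ := hHolder3 h3
        have d3 := delta3 f hf g hg hess hhess (q - 3) M (by linarith) hM hc hH3 x h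
        rw [← hΔ, ← hφ] at d3
        by_contra hneg
        push Not at hneg
        have := d3 ((φ + 1) / ‖Δ‖) (by positivity)
        rw [hM0, div_mul_cancel₀ _ hneg.ne'] at this
        simp at this
        linarith
    · have hr1 : lam * ‖h‖ ≤ G := by
        rcases hr.eq_or_lt with h0 | h0
        · rw [← h0, mul_zero]; exact hgpos.le
        · have : lam * ‖h‖ * ‖h‖ ≤ G * ‖h‖ := by nlinarith
          exact le_of_mul_le_mul_right this h0
      set τ := G / lam with hτ
      have hτ0 : 0 < τ := by positivity
      have hGτ : G = lam * τ := by rw [hτ]; field_simp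
      have hrτ : ‖h‖ ≤ τ := by rw [hτ, le_div_iff₀ hl]; linarith
      have hMτ : 6 * M * τ ^ (q - 2) ≤ lam := by
        rw [hτ, Real.div_rpow hgpos.le hlam0, ← mul_div_assoc, div_le_iff₀ (by positivity)]
        refine hpow.trans (le_of_eq ?_)
        rw [show q - 1 = 1 + (q - 2) by ring, Real.rpow_add hl, Real.rpow_one]
      rcases lt_or_ge q 3 with h3 | h3
      · obtain ⟨ξ, hξ, e⟩ := delta2 g hess hhess x h Δ
        have b := hHolder2 h3 (x + ξ • h) x
        rw [← hΔ, real_inner_self_eq_norm_sq, ← inner_sub_left, ← ContinuousLinearMap.sub_apply] at e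
        have b1 := real_inner_le_norm ((hess (x + ξ • h) - hess x) h) Δ
        have b2 := (hess (x + ξ • h) - hess x).le_opNorm h
        have b3 : ‖x + ξ • h - x‖ ^ (q - 2) ≤ τ ^ (q - 2) := by
          apply Real.rpow_le_rpow (norm_nonneg _) _ (by linarith)
          rw [add_sub_cancel_left, norm_smul, Real.norm_eq_abs, abs_of_pos hξ.1]
          nlinarith [hξ.2]
        have b4 : 0 ≤ M * τ ^ (q - 2) := by positivity
        have b5 : ‖hess (x + ξ • h) - hess x‖ ≤ lam := by
          have := mul_le_mul_of_nonneg_left b3 hM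
          linarith
        have b6 : ‖(hess (x + ξ • h) - hess x) h‖ ≤ lam * ‖h‖ :=
          b2.trans (mul_le_mul_of_nonneg_right b5 hr)
        rcases (norm_nonneg Δ).eq_or_lt with h0 | h0
        · rw [← h0]; positivity
        · have : ‖Δ‖ * ‖Δ‖ ≤ lam * ‖h‖ * ‖Δ‖ := by
            rw [← pow_two, e]
            exact b1.trans (mul_le_mul_of_nonneg_right b6 h0.le)
          exact le_of_mul_le_mul_right this h0
      · obtain ⟨hc, hH3⟩ := hHolder3 h3
        have d3 := delta3 f hf g hg hess hhess (q - 3) M (by linarith) hM hc hH3 x h τ hτ0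
        rw [← hΔ, ← hφ] at d3
        have e1 : τ ^ (q - 2) = τ * τ ^ (q - 3) := by
          rw [show q - 2 = 1 + (q - 3) by ring, Real.rpow_add hτ0, Real.rpow_one]
        have e2 : ‖h‖ ^ (q - 3) ≤ τ ^ (q - 3) := Real.rpow_le_rpow hr hrτ (by linarith)
        rw [e1] at hMτ
        have e3 : τ * (M * ‖h‖ ^ (q - 3) * ‖h‖ ^ 2) ≤ τ * (M * τ ^ (q - 3) * ‖h‖ ^ 2) := by gcongr
        have e4 := mul_le_mul_of_nonneg_right hMτ (sq_nonneg ‖h‖)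
        have e5 : 0 ≤ lam * ‖h‖ ^ 2 := by positivity
        rw [hGτ] at hmono
        have : τ * ‖Δ‖ ≤ τ * (lam * ‖h‖) := by linarith
        exact le_of_mul_le_mul_left this hτ0
  have i1 : ⟪Δ - lam • h, -h⟫ = lam * ‖h‖ ^ 2 - ⟪Δ, h⟫ := by
    rw [inner_neg_right, inner_sub_left, real_inner_smul_left, real_inner_self_eq_norm_sq]; ring
  have i2 : ‖Δ - lam • h‖ ^ 2 = ‖Δ‖ ^ 2 - 2 * lam * ⟪Δ, h⟫ + lam ^ 2 * ‖h‖ ^ 2 := by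
    rw [norm_sub_sq_real, real_inner_smul_right, norm_smul, mul_pow, Real.norm_eq_abs, sq_abs]; ring
  rw [i1, i2]
  have i3 := real_inner_le_norm Δ h
  rcases hlam0.eq_or_lt with hl | hl
  · rw [← hl]
    rw [← hl, zero_mul] at key
    have : Δ = 0 := norm_le_zero_iff.1 key
    simp [this]
  · rw [ge_iff_le, div_le_iff₀ (by positivity)]
    have k1 : ‖Δ‖ ^ 2 ≤ (lam * ‖h‖) ^ 2 := by gcongr
    have k2 : ⟪Δ, h⟫ ≤ lam * ‖h‖ ^ 2 := by nlinarith [norm_nonneg h]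
    nlinarith
end

section
/- Fix q ∈ [2, 4] with M_q ∈ (0, ∞) (i.e. the Hessian is Hölder continuous of degree q − 2 with constant M_q if q < 3, and the third derivative is Hölder continuous of degree q − 3 with constant M_q if q ≥ 3). Let x ∈ dom ψ, s ∈ ∂ψ(x), g := ‖∇f(x) + s‖ > 0, set λ := (6 M_q g^{q−2})^{1/(q−1)}, and let T be a regularized Newton step from x with parameter λ (this is one iteration of the gradient-regularized Newton method). Then F(x) − F(T) ≥ ‖F'(T)‖²/(4λ) = (1/(4(6M_q)^{1/(q−1)})) · (‖F'(T)‖/g)² · g^{q/(q−1)}. -/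
open Set
open scoped RealInnerProductSpace

section aux
set_option linter.unusedSectionVars false
variable {E : Type*} [NormedAddCommGroup E] [InnerProductSpace ℝ E] [CompleteSpace E]

lemma aux_smul (C : ContinuousMultilinearMap ℝ (fun _ : Fin 3 => E) ℝ) (t : ℝ) (a b c : E) :
    C ![t • a, b, c] = t * C ![a, b, c] := by
  have e : ∀ u : E, ![u, b, c] = Function.update ![a, b, c] 0 u := by
    intro u; ext i; fin_cases i <;> rfl
  have := C.map_update_smul ![a, b, c] 0 t a
  rw [← e, ← e] at this
  simpa only [smul_eq_mul] using this

lemma aux_grad_line {f : E → ℝ} {g : E → E} (hg : ∀ y, HasGradientAt f (g y) y) (z d : E) (t : ℝ) :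
    HasDerivAt (fun t : ℝ => f (z + t • d)) ⟪g (z + t • d), d⟫ t := by
  have h1 : HasDerivAt (fun t : ℝ => z + t • d) d t := by
    simpa using ((hasDerivAt_id t).smul_const d).const_add z
  have h2 := (hg (z + t • d)).hasFDerivAt.comp_hasDerivAt t h1
  exact h2.congr_deriv (by simp)

lemma aux_g_line {g : E → E} {hess : E → E →L[ℝ] E} (hhess : ∀ y, HasFDerivAt g (hess y) y)
    (z d b : E) (t : ℝ) :
    HasDerivAt (fun t : ℝ => ⟪g (z + t • d), b⟫) ⟪hess (z + t • d) d, b⟫ t := by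
  have h1 : HasDerivAt (fun t : ℝ => z + t • d) d t := by
    simpa using ((hasDerivAt_id t).smul_const d).const_add z
  have h2 := (hhess (z + t • d)).comp_hasDerivAt t h1
  simpa using h2.inner ℝ (hasDerivAt_const t b)

lemma aux_grad_ineq {f : E → ℝ} (hf : ConvexOn ℝ Set.univ f) {g : E → E}
    (hg : ∀ y, HasGradientAt f (g y) y) (z y : E) : f z + ⟪g z, y - z⟫ ≤ f y := by
  have hc : ConvexOn ℝ Set.univ (fun t : ℝ => f (z + t • (y - z))) := by
    have := hf.comp_affineMap (AffineMap.lineMap z y : ℝ →ᵃ[ℝ] E)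
    have e : (fun t : ℝ => f (z + t • (y - z))) = f ∘ (AffineMap.lineMap z y : ℝ →ᵃ[ℝ] E) := by
      funext t
      simp [AffineMap.lineMap_apply, add_comm]
    rw [e]
    exact this
  have h := hc.le_slope_of_hasDerivAt (Set.mem_univ 0) (Set.mem_univ 1) zero_lt_one
    (aux_grad_line hg z (y - z) 0)
  simp [slope_def_field] at h
  linarith

lemma aux_psd {f : E → ℝ} (hf : ConvexOn ℝ Set.univ f) {g : E → E}
    (hg : ∀ y, HasGradientAt f (g y) y) {hess : E → E →L[ℝ] E}
    (hhess : ∀ y, HasFDerivAt g (hess y) y) (z d : E) : 0 ≤ ⟪hess z d, d⟫ := by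
  have hm : Monotone (fun t : ℝ => ⟪g (z + t • d), d⟫) := by
    intro a b hab
    rcases hab.eq_or_lt with h | h
    · simp [h]
    have h1 := aux_grad_ineq hf hg (z + a • d) (z + b • d)
    have h2 := aux_grad_ineq hf hg (z + b • d) (z + a • d)
    have e1 : (z + b • d) - (z + a • d) = (b - a) • d := by module
    have e2 : (z + a • d) - (z + b • d) = (-(b - a)) • d := by module
    rw [e1, inner_smul_right] at h1
    rw [e2, inner_smul_right] at h2
    have : (b - a) * ⟪g (z + a • d), d⟫ ≤ (b - a) * ⟪g (z + b • d), d⟫ := by linarith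
    exact le_of_mul_le_mul_left this (by linarith)
  have h := hm.deriv_nonneg (x := 0)
  rw [(aux_g_line hhess z d d 0).deriv] at h
  simpa using h

lemma aux_mv {φ φ' : ℝ → ℝ} {C : ℝ} (h : ∀ t, HasDerivAt φ (φ' t) t)
    (hb : ∀ t ∈ Set.Icc (0:ℝ) 1, |φ' t| ≤ C) : |φ 1 - φ 0| ≤ C := by
  have := (convex_Icc (0:ℝ) 1).norm_image_sub_le_of_norm_hasDerivWithin_le
    (f := φ) (f' := φ') (C := C)
    (fun t _ => (h t).hasDerivWithinAt) (fun t ht => hb t ht)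
    (Set.left_mem_Icc.2 zero_le_one) (Set.right_mem_Icc.2 zero_le_one)
  simpa using this

lemma aux_fderiv_f {f : E → ℝ} {g : E → E}
    (hg : ∀ y, HasGradientAt f (g y) y) (z c : E) : fderiv ℝ f z c = ⟪g z, c⟫ := by
  rw [(hg z).hasFDerivAt.fderiv]; simp

lemma aux_fderiv_p {f : E → ℝ} {g : E → E}
    (hg : ∀ y, HasGradientAt f (g y) y) {hess : E → E →L[ℝ] E}
    (hhess : ∀ y, HasFDerivAt g (hess y) y) (z b c : E) :
    fderiv ℝ (fun z => fderiv ℝ f z c) z b = ⟪hess z b, c⟫ := by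
  have : (fun z => fderiv ℝ f z c) = fun z => ⟪g z, c⟫ := by
    funext z; exact aux_fderiv_f hg z c
  rw [this]
  have h2 := (hhess z).inner ℝ (hasFDerivAt_const c z)
  rw [h2.fderiv]; simp

lemma aux_D2 {f : E → ℝ} {g : E → E}
    (hg : ∀ y, HasGradientAt f (g y) y) {hess : E → E →L[ℝ] E}
    (hhess : ∀ y, HasFDerivAt g (hess y) y) (hC : ContDiff ℝ 3 f) (z b c : E) :
    iteratedFDeriv ℝ 2 f z ![b, c] = ⟪hess z b, c⟫ := by
  rw [iteratedFDeriv_two_apply, ← aux_fderiv_p hg hhess z b c]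
  have hd : DifferentiableAt ℝ (fderiv ℝ f) z :=
    ((hC.fderiv_right (m := 2) (by norm_num)).differentiable (by norm_num)) z
  rw [fderiv_clm_apply hd (differentiableAt_const c)]
  simp

lemma aux_D3 {f : E → ℝ} {g : E → E}
    (hg : ∀ y, HasGradientAt f (g y) y) {hess : E → E →L[ℝ] E}
    (hhess : ∀ y, HasFDerivAt g (hess y) y) (hC : ContDiff ℝ 3 f) (z a b c : E) :
    HasDerivAt (fun t : ℝ => ⟪hess (z + t • a) b, c⟫) (iteratedFDeriv ℝ 3 f z ![a, b, c]) 0 := by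
  have hd : DifferentiableAt ℝ (iteratedFDeriv ℝ 2 f) z :=
    (hC.differentiable_iteratedFDeriv (m := 2) (by norm_cast)) z
  have h1 : HasDerivAt (fun t : ℝ => z + t • a) a 0 := by
    simpa using ((hasDerivAt_id (0:ℝ)).smul_const a).const_add z
  have hd' : HasFDerivAt (iteratedFDeriv ℝ 2 f) (fderiv ℝ (iteratedFDeriv ℝ 2 f) z)
      (z + (0:ℝ) • a) := by simpa using hd.hasFDerivAt
  have h2 := hd'.comp_hasDerivAt 0 h1
  have h3 := ((ContinuousMultilinearMap.apply ℝ (fun _ : Fin 2 => E) ℝ ![b, c]).hasFDerivAt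
    (x := iteratedFDeriv ℝ 2 f (z + (0:ℝ) • a))).comp_hasDerivAt 0 h2
  rw [iteratedFDeriv_succ_apply_left]
  have e : (fun t : ℝ => ⟪hess (z + t • a) b, c⟫) =
      (ContinuousMultilinearMap.apply ℝ (fun _ : Fin 2 => E) ℝ ![b, c]) ∘
        iteratedFDeriv ℝ 2 f ∘ fun t : ℝ => z + t • a := by
    funext t
    exact (aux_D2 hg hhess hC _ b c).symm
  rw [e]
  exact h3

lemma aux_D3_line {f : E → ℝ} {g : E → E}
    (hg : ∀ y, HasGradientAt f (g y) y) {hess : E → E →L[ℝ] E}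
    (hhess : ∀ y, HasFDerivAt g (hess y) y) (hC : ContDiff ℝ 3 f) (z a b c : E) (t : ℝ) :
    HasDerivAt (fun t : ℝ => ⟪hess (z + t • a) b, c⟫)
      (iteratedFDeriv ℝ 3 f (z + t • a) ![a, b, c]) t := by
  have h := aux_D3 hg hhess hC (z + t • a) a b c
  have h' : HasDerivAt (fun u : ℝ => ⟪hess (z + t • a + u • a) b, c⟫)
      (iteratedFDeriv ℝ 3 f (z + t • a) ![a, b, c]) (t - t) := by simpa using h
  have := h'.comp_sub_const t t
  have e : (fun u : ℝ => ⟪hess (z + u • a) b, c⟫) =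
      fun u : ℝ => ⟪hess (z + t • a + (u - t) • a) b, c⟫ := by
    funext u
    have : z + u • a = z + t • a + (u - t) • a := by module
    rw [this]
  rw [e]
  exact this

lemma aux_key {f : E → ℝ} {g : E → E}
    (hg : ∀ y, HasGradientAt f (g y) y) {hess : E → E →L[ℝ] E}
    (hhess : ∀ y, HasFDerivAt g (hess y) y) (hC : ContDiff ℝ 3 f) (z a b c : E) :
    iteratedFDeriv ℝ 3 f z ![a, b, c] =
      fderiv ℝ (fderiv ℝ (fun z => fderiv ℝ f z c)) z a b := by
  have hp : ContDiff ℝ 2 (fun z => fderiv ℝ f z c) :=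
    (hC.fderiv_right (m := 2) (by norm_num)).clm_apply contDiff_const
  have hd : DifferentiableAt ℝ (fderiv ℝ (fun z => fderiv ℝ f z c)) z :=
    ((hp.fderiv_right (m := 1) (by norm_num)).differentiable (by norm_num)) z
  have h4 := aux_D3 hg hhess hC z a b c
  have e : (fun t : ℝ => ⟪hess (z + t • a) b, c⟫) =
      fun t : ℝ => fderiv ℝ (fun z => fderiv ℝ f z c) (z + t • a) b := by
    funext t; exact (aux_fderiv_p hg hhess _ b c).symm
  rw [e] at h4
  generalize fderiv ℝ (fun z => fderiv ℝ f z c) = P at *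
  have h1 : HasDerivAt (fun t : ℝ => z + t • a) a 0 := by
    simpa using ((hasDerivAt_id (0:ℝ)).smul_const a).const_add z
  have hd' : HasFDerivAt P (fderiv ℝ P z) (z + (0:ℝ) • a) := by
    simpa using hd.hasFDerivAt
  have h2 := hd'.comp_hasDerivAt 0 h1
  have h3 := ((ContinuousLinearMap.apply ℝ ℝ b).hasFDerivAt
    (x := P (z + (0:ℝ) • a))).comp_hasDerivAt 0 h2
  exact h4.unique h3

lemma aux_D3_symm {f : E → ℝ} {g : E → E}
    (hg : ∀ y, HasGradientAt f (g y) y) {hess : E → E →L[ℝ] E}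
    (hhess : ∀ y, HasFDerivAt g (hess y) y) (hC : ContDiff ℝ 3 f) (z h v : E) :
    iteratedFDeriv ℝ 3 f z ![h, h, v] = iteratedFDeriv ℝ 3 f z ![v, h, h] := by
  have hsym : ∀ y b c : E, ⟪hess y b, c⟫ = ⟪hess y c, b⟫ := by
    intro y b c
    rw [← aux_D2 hg hhess hC, ← aux_D2 hg hhess hC, iteratedFDeriv_two_apply,
      iteratedFDeriv_two_apply]
    have hC2 : ContDiff ℝ 2 f := hC.of_le (by norm_num)
    exact (hC2.contDiffAt.isSymmSndFDerivAt (by simp)) b c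
  have e1 : iteratedFDeriv ℝ 3 f z ![h, h, v] = iteratedFDeriv ℝ 3 f z ![h, v, h] := by
    have h1 := aux_D3 hg hhess hC z h h v
    have h2 := aux_D3 hg hhess hC z h v h
    have : (fun t : ℝ => ⟪hess (z + t • h) h, v⟫) = fun t : ℝ => ⟪hess (z + t • h) v, h⟫ := by
      funext t; exact hsym _ _ _
    rw [this] at h1
    exact h1.unique h2
  rw [e1]
  have key := aux_key hg hhess hC z
  rw [key, key]
  have hp : ContDiff ℝ 2 (fun z => fderiv ℝ f z h) :=
    (hC.fderiv_right (m := 2) (by norm_num)).clm_apply contDiff_const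
  exact (hp.contDiffAt.isSymmSndFDerivAt (by simp)) h v

lemma aux_hess {f : E → ℝ} {g : E → E}
    (hg : ∀ y, HasGradientAt f (g y) y) {hess : E → E →L[ℝ] E}
    (hhess : ∀ y, HasFDerivAt g (hess y) y) (hC : ContDiff ℝ 3 f) {q M : ℝ} (hM : 0 < M)
    (hq : 3 ≤ q) (hH : ∀ y z : E,
      ‖iteratedFDeriv ℝ 3 f y - iteratedFDeriv ℝ 3 f z‖ ≤ M * ‖y - z‖ ^ (q - 3))
    (x d b c : E) :
    |⟪hess (x + d) b, c⟫ - ⟪hess x b, c⟫ - iteratedFDeriv ℝ 3 f x ![d, b, c]| ≤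
      M * ‖d‖ ^ (q - 2) * ‖b‖ * ‖c‖ := by
  have h : ∀ t : ℝ, HasDerivAt
      (fun t : ℝ => ⟪hess (x + t • d) b, c⟫ - t * iteratedFDeriv ℝ 3 f x ![d, b, c])
      (iteratedFDeriv ℝ 3 f (x + t • d) ![d, b, c] - iteratedFDeriv ℝ 3 f x ![d, b, c]) t := by
    intro t
    have := (aux_D3_line hg hhess hC x d b c t).sub
      ((hasDerivAt_id t).mul_const (iteratedFDeriv ℝ 3 f x ![d, b, c]))
    exact this.congr_deriv (by simp)
  have := aux_mv (C := M * ‖d‖ ^ (q - 2) * ‖b‖ * ‖c‖) h (by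
    intro t ht
    rw [← sub_apply]
    have h1 := (iteratedFDeriv ℝ 3 f (x + t • d) - iteratedFDeriv ℝ 3 f x).le_opNorm ![d, b, c]
    simp only [Fin.prod_univ_three, Matrix.cons_val_zero, Matrix.cons_val_one,
      Matrix.cons_val, Real.norm_eq_abs] at h1
    refine h1.trans ?_
    have h2 : ‖iteratedFDeriv ℝ 3 f (x + t • d) - iteratedFDeriv ℝ 3 f x‖ ≤ M * ‖d‖ ^ (q - 3) := by
      refine (hH _ _).trans ?_
      gcongr
      rw [add_sub_cancel_left, norm_smul, Real.norm_eq_abs, abs_of_nonneg ht.1]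
      exact mul_le_of_le_one_left (norm_nonneg _) ht.2
    have e : ‖d‖ ^ (q - 2) = ‖d‖ ^ (q - 3) * ‖d‖ := by
      rw [← Real.rpow_add_one' (norm_nonneg _) (by linarith)]
      congr 1; ring
    rw [e]
    calc _ ≤ (M * ‖d‖ ^ (q - 3)) * (‖d‖ * ‖b‖ * ‖c‖) := by gcongr
      _ = _ := by ring)
  convert this using 1
  simp
  congr 1; ring

lemma aux_rem {f : E → ℝ} {g : E → E}
    (hg : ∀ y, HasGradientAt f (g y) y) {hess : E → E →L[ℝ] E}
    (hhess : ∀ y, HasFDerivAt g (hess y) y) (hC : ContDiff ℝ 3 f) {q M : ℝ} (hM : 0 < M)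
    (hq : 3 ≤ q) (hH : ∀ y z : E,
      ‖iteratedFDeriv ℝ 3 f y - iteratedFDeriv ℝ 3 f z‖ ≤ M * ‖y - z‖ ^ (q - 3))
    (x d c : E) :
    |⟪g (x + d) - g x - hess x d, c⟫ - 1 / 2 * iteratedFDeriv ℝ 3 f x ![d, d, c]| ≤
      M * ‖d‖ ^ (q - 2) * ‖d‖ * ‖c‖ := by
  have h : ∀ t : ℝ, HasDerivAt
      (fun t : ℝ => ⟪g (x + t • d), c⟫ - t * ⟪hess x d, c⟫
        - t ^ 2 / 2 * iteratedFDeriv ℝ 3 f x ![d, d, c])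
      (⟪hess (x + t • d) d, c⟫ - ⟪hess x d, c⟫ - t * iteratedFDeriv ℝ 3 f x ![d, d, c]) t := by
    intro t
    have := ((aux_g_line hhess x d c t).sub
      ((hasDerivAt_id t).mul_const ⟪hess x d, c⟫)).sub
      ((((hasDerivAt_id t).pow 2).div_const 2).mul_const (iteratedFDeriv ℝ 3 f x ![d, d, c]))
    exact this.congr_deriv (by simp)
  have := aux_mv (C := M * ‖d‖ ^ (q - 2) * ‖d‖ * ‖c‖) h (by
    intro t ht
    have h1 := aux_hess hg hhess hC hM hq hH x (t • d) d c
    have e : iteratedFDeriv ℝ 3 f x ![t • d, d, c] = t * iteratedFDeriv ℝ 3 f x ![d, d, c] := aux_smul _ _ _ _ _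
    rw [e] at h1
    refine h1.trans ?_
    gcongr
    · linarith
    rw [norm_smul, Real.norm_eq_abs, abs_of_nonneg ht.1]
    exact mul_le_of_le_one_left (norm_nonneg _) ht.2)
  convert this using 1
  simp [inner_sub_left]
  congr 1; ring

end aux

/-- Fix `q ∈ [2,4]` with `M_q = M ∈ (0,∞)`: the Hessian of the convex
function `f` is Hölder continuous of degree `q - 2` with constant `M` if `q < 3`, and the
third derivative is Hölder continuous of degree `q - 3` with constant `M` if `q ≥ 3`.
Let `s ∈ ∂ψ(x)`, `g := ‖∇f(x) + s‖ > 0`, set `λ := (6 M g^{q-2})^{1/(q-1)}`, and let `T` be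
a regularized Newton step from `x` with parameter `λ` (one iteration of the
gradient-regularized Newton method), with `ψ'(T) = -∇f(x) - ∇²f(x)(T-x) - λ(T-x) ∈ ∂ψ(T)`
and `F'(T) = ∇f(T) + ψ'(T)`. Then, with `F = f + ψ`,
`F(x) - F(T) ≥ ‖F'(T)‖²/(4λ) = (1/(4(6M)^{1/(q-1)})) · (‖F'(T)‖/g)² · g^{q/(q-1)}`. -/
theorem statement_11 {E : Type*} [NormedAddCommGroup E] [InnerProductSpace ℝ E] [CompleteSpace E]
    (f ψ : E → ℝ) (hf : ConvexOn ℝ Set.univ f) (hψ : ConvexOn ℝ Set.univ ψ)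
    (g : E → E) (hg : ∀ y, HasGradientAt f (g y) y)
    (hess : E → E →L[ℝ] E) (hhess : ∀ y, HasFDerivAt g (hess y) y)
    (q M : ℝ) (hq1 : 2 ≤ q) (hq2 : q ≤ 4) (hM : 0 < M)
    (hHolder2 : q < 3 → ∀ y z : E, ‖hess y - hess z‖ ≤ M * ‖y - z‖ ^ (q - 2))
    (hHolder3 : 3 ≤ q → ContDiff ℝ 3 f ∧ ∀ y z : E,
      ‖iteratedFDeriv ℝ 3 f y - iteratedFDeriv ℝ 3 f z‖ ≤ M * ‖y - z‖ ^ (q - 3))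
    (x s : E) (hs : IsSubgradAt ψ s x)
    (gn : ℝ) (hgn : gn = ‖g x + s‖) (hgpos : 0 < gn)
    (lam : ℝ) (hlam : lam = (6 * M * gn ^ (q - 2)) ^ ((1 : ℝ) / (q - 1)))
    (T w : E) (hw : w = -(g x) - hess x (T - x) - lam • (T - x))
    (hT : IsSubgradAt ψ w T) :
    (f x + ψ x) - (f T + ψ T) ≥ ‖g T + w‖ ^ 2 / (4 * lam) ∧
      ‖g T + w‖ ^ 2 / (4 * lam) =
        1 / (4 * (6 * M) ^ ((1 : ℝ) / (q - 1))) * (‖g T + w‖ / gn) ^ 2 *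
          gn ^ (q / (q - 1)) := by
  have hq0 : 0 < q - 1 := by linarith
  have hA : 0 < 6 * M * gn ^ (q - 2) := by positivity
  have hl : 0 < lam := by rw [hlam]; positivity
  have hlp : lam ^ (q - 1) = 6 * M * gn ^ (q - 2) := by
    rw [hlam, ← Real.rpow_mul hA.le, one_div, inv_mul_cancel₀ hq0.ne', Real.rpow_one]
  set ρ := gn / lam with hρ
  have hρ0 : 0 < ρ := by positivity
  have hgρ : gn = lam * ρ := by rw [hρ]; field_simp
  have hMρ : M * ρ ^ (q - 2) = lam / 6 := by
    have e : lam ^ (q - 1) = lam ^ (q - 2) * lam := by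
      rw [← Real.rpow_add_one hl.ne']; congr 1; ring
    rw [hρ, Real.div_rpow hgpos.le hl.le]
    have : 0 < lam ^ (q - 2) := by positivity
    field_simp
    rw [e] at hlp
    linarith
  constructor
  · have hmon : lam * ‖T - x‖ ^ 2 + ⟪hess x (T - x), T - x⟫ ≤ gn * ‖T - x‖ := by
      have h1 := hs T
      have h2 := hT x
      have e : ⟪w, x - T⟫ = ⟪g x, T - x⟫ + ⟪hess x (T - x), T - x⟫ + lam * ‖T - x‖ ^ 2 := by
        rw [← neg_sub T x, hw, inner_neg_right, inner_sub_left, inner_sub_left, inner_neg_left,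
          real_inner_smul_left, real_inner_self_eq_norm_sq]
        ring
      have h3 := neg_le_of_abs_le (abs_real_inner_le_norm (g x + s) (T - x))
      rw [inner_add_left, ← hgn] at h3
      linarith
    have hpsd := aux_psd hf hg hhess
    have hr : ‖T - x‖ ≤ ρ := by
      rcases (norm_nonneg (T - x)).eq_or_lt with h | h
      · rw [← h]; exact hρ0.le
      have h0 := hpsd x (T - x)
      have : lam * ‖T - x‖ * ‖T - x‖ ≤ lam * ρ * ‖T - x‖ := by rw [← hgρ]; nlinarith
      exact le_of_mul_le_mul_left (le_of_mul_le_mul_right this h) hl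
    have hMr : M * ‖T - x‖ ^ (q - 2) ≤ lam / 6 := by
      rw [← hMρ]; gcongr
    have hG : ‖g T - g x - hess x (T - x)‖ ≤ lam * ‖T - x‖ := by
      rcases lt_or_ge q 3 with h3 | h3
      · have hb := (convex_segment x T).norm_image_sub_le_of_norm_hasFDerivWithin_le
          (f := fun y => g y - hess x y) (f' := fun y => hess y - hess x) (C := lam / 6)
          (fun y _ => ((hhess y).sub (hess x).hasFDerivAt).hasFDerivWithinAt)
          (fun y hy => by
            refine (hHolder2 h3 y x).trans (le_trans ?_ hMr)
            have : ‖y - x‖ ≤ ‖T - x‖ := norm_sub_le_of_mem_segment hy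
            gcongr)
          (left_mem_segment ℝ x T) (right_mem_segment ℝ x T)
        have e : g T - g x - hess x (T - x) = g T - hess x T - (g x - hess x x) := by
          rw [map_sub]; abel
        rw [e]
        refine hb.trans ?_
        gcongr; linarith
      · obtain ⟨hC, hH⟩ := hHolder3 h3
        rcases (norm_nonneg (g T - g x - hess x (T - x))).eq_or_lt with h0 | h0
        · rw [← h0]; positivity
        set G := g T - g x - hess x (T - x) with hGdef
        set r := ‖T - x‖ with hrdef
        have hr0 : 0 ≤ r := norm_nonneg _
        set v := (ρ / ‖G‖) • G with hv
        have hvn : ‖v‖ = ρ := by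
          rw [hv, norm_smul, Real.norm_eq_abs, abs_of_pos (by positivity)]; field_simp
        have hGv : ⟪G, v⟫ = ρ * ‖G‖ := by
          rw [hv, inner_smul_right, real_inner_self_eq_norm_sq]; field_simp
        have h1 := aux_rem hg hhess hC hM h3 hH x (T - x) v
        rw [add_sub_cancel, ← hGdef, hGv, hvn, aux_D3_symm hg hhess hC, ← hrdef] at h1
        have h2 := aux_hess hg hhess hC hM h3 hH x (-v) (T - x) (T - x)
        have e : iteratedFDeriv ℝ 3 f x ![-v, T - x, T - x] =
            - iteratedFDeriv ℝ 3 f x ![v, T - x, T - x] := by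
          have := aux_smul (iteratedFDeriv ℝ 3 f x) (-1) v (T - x) (T - x)
          rw [neg_one_smul] at this
          linarith
        rw [e, norm_neg, hvn, hMρ, ← hrdef] at h2
        have h4 := hpsd (x + -v) (T - x)
        have h5 := (abs_le.1 h2).2
        have h6 := (abs_le.1 h1).2
        have h7 : M * r ^ (q - 2) * r * ρ ≤ lam / 6 * r * ρ := by gcongr
        have h8 : lam / 6 * r * r ≤ lam / 6 * ρ * r := by gcongr
        rw [hgρ] at hmon
        have h9 : 0 ≤ lam * r ^ 2 := by positivity
        have h10 : 0 ≤ lam * r * ρ := by positivity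
        have : ρ * ‖G‖ ≤ ρ * (lam * r) := by
          linarith
        exact le_of_mul_le_mul_left this hρ0
    have hGe : g T - g x - hess x (T - x) = (g T + w) + lam • (T - x) := by
      rw [hw]; abel
    rw [hGe] at hG
    have h1 := aux_grad_ineq hf hg T x
    have h2 := hT x
    have h3 : ‖(g T + w) + lam • (T - x)‖ ^ 2 ≤ (lam * ‖T - x‖) ^ 2 := by gcongr
    rw [norm_add_sq_real, norm_smul, inner_smul_right, Real.norm_eq_abs, abs_of_pos hl] at h3
    have h4 : ⟪g T, x - T⟫ + ⟪w, x - T⟫ = - ⟪g T + w, T - x⟫ := by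
      rw [← inner_add_left, ← inner_neg_right, neg_sub]
    rw [ge_iff_le, div_le_iff₀ (by positivity)]
    have h5 : lam * (-⟪g T + w, T - x⟫) ≤ lam * ((f x + ψ x) - (f T + ψ T)) := by
      gcongr; linarith
    nlinarith [sq_nonneg ‖g T + w‖]
  · have e : lam = (6 * M) ^ ((1 : ℝ) / (q - 1)) * gn ^ ((q - 2) / (q - 1)) := by
      rw [hlam, Real.mul_rpow (by positivity) (by positivity), ← Real.rpow_mul hgpos.le]
      congr 2; ring
    have e2 : gn ^ (q / (q - 1)) * gn ^ ((q - 2) / (q - 1)) = gn ^ 2 := by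
      rw [← Real.rpow_add hgpos, ← Real.rpow_natCast]
      congr 1; push_cast; field_simp; ring
    rw [e]
    have p1 : 0 < (6 * M) ^ ((1 : ℝ) / (q - 1)) := by positivity
    have p2 : 0 < gn ^ ((q - 2) / (q - 1)) := by positivity
    generalize (6 * M) ^ ((1 : ℝ) / (q - 1)) = A at *
    generalize gn ^ ((q - 2) / (q - 1)) = B at *
    generalize gn ^ (q / (q - 1)) = D at *
    rw [div_pow, ← e2]
    have p3 : D ≠ 0 := by
      rintro rfl
      have : 0 < gn ^ 2 := by positivity
      linarith
    field_simp
end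

section
/- Let q ∈ [2, 4], M > 0, D > 0, and set β := 1/(q − 1). Let (F_k)_{k≥0} and (g_k)_{k≥0} be sequences of positive reals such that for every k ≥ 0: F_k − F_{k+1} ≥ (1/(16(6M)^β)) · (g_{k+1}/g_k)² · g_k^{q/(q−1)} and g_k ≥ F_k/D. Then for every k ≥ 1, F_k ≤ 6 M D^q · (32(q − 1)/k)^{q−1} + g_0 D · exp(−k/4). -/
theorem aux_conv (x y b : ℝ) (hx : 0 < x) (hy : 0 < y) (hb : 0 < b) :
    b * x ^ (-(1 + b)) * (x - y) ≤ y ^ (-b) - x ^ (-b) := by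
  have ht : 0 < y / x := div_pos hy hx
  have h1 : 1 - b * (y / x - 1) ≤ (y / x) ^ (-b) := by
    rw [Real.rpow_def_of_pos ht]
    have := Real.add_one_le_exp (Real.log (y / x) * -b)
    have h2 := mul_le_mul_of_nonneg_left (Real.log_le_sub_one_of_pos ht) hb.le
    linarith
  rw [Real.div_rpow hy.le hx.le, le_div_iff₀ (Real.rpow_pos_of_pos hx _)] at h1
  have h3 : x ^ (-(1 + b)) = x ^ (-b) / x := by
    rw [show -(1 + b) = -b - 1 by ring, Real.rpow_sub hx, Real.rpow_one]
  have h4 : b * (x ^ (-b) / x) * (x - y) = (1 - b * (y / x - 1)) * x ^ (-b) - x ^ (-b) := by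
    field_simp
    ring
  rw [h3, h4]
  linarith

theorem aux_log (r : ℝ) (hr : 0 < r) : 1 / 2 * (3 / 2 + 2 * Real.log r) ≤ r ^ 2 := by
  by_cases h : 3 / 2 + 2 * Real.log r ≤ 0
  · nlinarith [sq_nonneg r]
  have h1 := Real.add_one_le_exp (2 * Real.log r + 1 / 2)
  have h2 : Real.exp (2 * Real.log r + 1 / 2) = r ^ 2 * Real.exp (1 / 2) := by
    rw [Real.exp_add, two_mul, Real.exp_add, Real.exp_log hr]; ring
  have h3 : Real.exp (1 / 2) ≤ 2 := by
    have h5 : Real.exp (1 / 2) * Real.exp (1 / 2) = Real.exp 1 := by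
      rw [← Real.exp_add]; norm_num
    nlinarith [Real.exp_one_lt_d9, Real.exp_pos (1 / 2)]
  have := mul_le_mul_of_nonneg_left h3 (sq_nonneg r)
  linarith

/-- (Global rate of the Super-Universal Newton Method, sequence form.)
Let `q ∈ [2,4]`, `M > 0`, `D > 0`, `β := 1/(q-1)`. If positive sequences `(F_k)`, `(g_k)`
satisfy, for all `k`, `F_k - F_{k+1} ≥ (1/(16(6M)^β)) (g_{k+1}/g_k)² g_k^{q/(q-1)}` and
`g_k ≥ F_k/D`, then for every `k ≥ 1`,
`F_k ≤ 6 M D^q (32(q-1)/k)^{q-1} + g_0 D exp(-k/4)`. -/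
theorem statement_12 (q M D : ℝ) (hq1 : 2 ≤ q) (hq2 : q ≤ 4) (hM : 0 < M) (hD : 0 < D)
    (F g : ℕ → ℝ) (hFpos : ∀ k, 0 < F k) (hgpos : ∀ k, 0 < g k)
    (hstep : ∀ k : ℕ,
      F k - F (k + 1) ≥
        1 / (16 * (6 * M) ^ ((1 : ℝ) / (q - 1))) * (g (k + 1) / g k) ^ 2 *
          g k ^ (q / (q - 1)))
    (hgF : ∀ k : ℕ, g k ≥ F k / D) :
    ∀ k : ℕ, 1 ≤ k →
      F k ≤ 6 * M * D ^ q * (32 * (q - 1) / (k : ℝ)) ^ (q - 1) +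
        g 0 * D * Real.exp (-(k : ℝ) / 4) := by
  have hp : 0 < q - 1 := by linarith
  obtain ⟨b, hbdef⟩ : ∃ b : ℝ, b = 1 / (q - 1) := ⟨_, rfl⟩
  have hb : 0 < b := by rw [hbdef]; positivity
  have hbq : b * (q - 1) = 1 := by rw [hbdef]; field_simp
  have hqb : q / (q - 1) = 1 + b := by rw [hbdef]; field_simp; ring
  have h6 : 0 < (6 * M) ^ b := Real.rpow_pos_of_pos (by positivity) _
  rw [hqb, ← hbdef] at hstep
  obtain ⟨A, hA⟩ : ∃ A : ℝ, A = b * (1 / (16 * (6 * M) ^ b)) / D ^ (1 + b) := ⟨_, rfl⟩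
  have hDp : 0 < D ^ (1 + b) := Real.rpow_pos_of_pos hD _
  have hApos : 0 < A := by rw [hA]; positivity
  have key : ∀ k, A * (g (k + 1) / g k) ^ 2 ≤ F (k + 1) ^ (-b) - F k ^ (-b) := by
    intro k
    refine le_trans ?_ (aux_conv (F k) (F (k + 1)) b (hFpos k) (hFpos _) hb)
    have h1 : F k ^ (1 + b) / D ^ (1 + b) ≤ g k ^ (1 + b) := by
      rw [← Real.div_rpow (hFpos k).le hD.le]
      exact Real.rpow_le_rpow (div_pos (hFpos k) hD).le (hgF k) (by positivity)
    have hFp : 0 < F k ^ (1 + b) := Real.rpow_pos_of_pos (hFpos k) _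
    have h2 : 1 / (16 * (6 * M) ^ b) * (g (k + 1) / g k) ^ 2 *
        (F k ^ (1 + b) / D ^ (1 + b)) ≤ F k - F (k + 1) :=
      le_trans (mul_le_mul_of_nonneg_left h1 (by positivity)) (hstep k)
    rw [Real.rpow_neg (hFpos k).le]
    have h3 := mul_le_mul_of_nonneg_left h2
      (show 0 ≤ b * (F k ^ (1 + b))⁻¹ by positivity)
    refine le_trans (le_of_eq ?_) h3
    rw [hA]
    field_simp
  have hsum : ∀ n : ℕ, A * (1 / 2 * (3 / 2 * n + 2 * (Real.log (g n) - Real.log (g 0))))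
      ≤ F n ^ (-b) := by
    intro n
    induction n with
    | zero => simpa using (Real.rpow_pos_of_pos (hFpos 0) (-b)).le
    | succ n ih =>
      have h1 := aux_log (g (n + 1) / g n) (div_pos (hgpos _) (hgpos _))
      rw [Real.log_div (hgpos _).ne' (hgpos _).ne'] at h1
      have h2 := mul_le_mul_of_nonneg_left h1 hApos.le
      have h3 := key n
      push_cast
      linarith
  intro n hn
  have hn0 : (0 : ℝ) < n := by exact_mod_cast hn
  have hX : 0 < 32 * (q - 1) / (n : ℝ) := by positivity
  by_cases hc : F n ≤ g 0 * D * Real.exp (-(n : ℝ) / 4)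
  · have : 0 ≤ 6 * M * D ^ q * (32 * (q - 1) / (n : ℝ)) ^ (q - 1) := by positivity
    linarith
  push Not at hc
  have hg : g 0 * Real.exp (-(n : ℝ) / 4) ≤ g n := by
    refine le_trans ?_ (hgF n)
    rw [le_div_iff₀ hD]
    linarith
  have hlog := Real.log_le_log (mul_pos (hgpos 0) (Real.exp_pos _)) hg
  rw [Real.log_mul (hgpos 0).ne' (Real.exp_pos _).ne', Real.log_exp] at hlog
  have h1 : A * n / 2 ≤ F n ^ (-b) := by
    refine le_trans ?_ (hsum n)
    rw [mul_div_assoc]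
    exact mul_le_mul_of_nonneg_left (by linarith) hApos.le
  have hFb : 0 < F n ^ b := Real.rpow_pos_of_pos (hFpos n) _
  have h2 : F n ^ b ≤ 32 * (q - 1) / n * (6 * M) ^ b * D ^ (1 + b) := by
    rw [Real.rpow_neg (hFpos n).le, le_inv_comm₀ (by positivity) hFb] at h1
    refine le_trans h1 (le_of_eq ?_)
    rw [hA]
    have : q - 1 = 1 / b := by rw [hbdef]; field_simp
    rw [this]
    field_simp
    norm_num
  have h3 := Real.rpow_le_rpow hFb.le h2 hp.le
  rw [← Real.rpow_mul (hFpos n).le, hbq, Real.rpow_one,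
    Real.mul_rpow (by positivity) hDp.le, Real.mul_rpow hX.le h6.le,
    ← Real.rpow_mul (by positivity), ← Real.rpow_mul hD.le, hbq, Real.rpow_one,
    show (1 + b) * (q - 1) = q by linarith] at h3
  have : 0 < g 0 * D * Real.exp (-(n : ℝ) / 4) :=
    mul_pos (mul_pos (hgpos 0) hD) (Real.exp_pos _)
  linarith
end

section
/- Let F₀ be a subset of a real inner product space E, V > 0, and β : F₀ × F₀ → ℝ a function with 0 < β(x, y) ≤ V whenever x ≠ y. Set D := sup_{x, y ∈ F₀} ‖x − y‖, and for s ≥ 2 define D_s := sup_{x, y ∈ F₀, x ≠ y} ‖x − y‖ · (V/β(x, y))^{1/s}. Assume D < ∞. Then for any q ≥ 2 and any 2 ≤ s ≤ q with D_s < ∞, one has (D_q/D)^q ≤ (D_s/D)^s, equivalently D_q^q ≤ D^{q−s} · D_s^s. -/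
open Set
open scoped ENNReal

/-- The `s`-relative size `D_s` of a set `F₀` with respect to a divergence `β` and scale `V`:
`D_s = sup_{x, y ∈ F₀, x ≠ y} ‖x - y‖ · (V/β(x,y))^{1/s}`, as an extended nonnegative real. -/
noncomputable def relSize {E : Type*} [NormedAddCommGroup E] [InnerProductSpace ℝ E]
    (F₀ : Set E) (V : ℝ) (β : E → E → ℝ) (s : ℝ) : ℝ≥0∞ :=
  ⨆ (x : E) (_ : x ∈ F₀) (y : E) (_ : y ∈ F₀) (_ : x ≠ y),
    ENNReal.ofReal (‖x - y‖ * (V / β x y) ^ (1 / s))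

/-- The diameter `D = sup_{x, y ∈ F₀} ‖x - y‖` of `F₀`, as an extended nonnegative real. -/
noncomputable def setDiam {E : Type*} [NormedAddCommGroup E] [InnerProductSpace ℝ E]
    (F₀ : Set E) : ℝ≥0∞ :=
  ⨆ (x : E) (_ : x ∈ F₀) (y : E) (_ : y ∈ F₀), ENNReal.ofReal ‖x - y‖

/-- (Lifting property.) Let `F₀ ⊆ E`, `V > 0`, and `β` satisfy
`0 < β(x,y) ≤ V` on distinct pairs of `F₀`; let `D` be the diameter of `F₀`, `D < ∞`.
Then for any `q ≥ 2` and `2 ≤ s ≤ q` with `D_s < ∞`, one has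
`(D_q/D)^q ≤ (D_s/D)^s`, equivalently `D_q^q ≤ D^{q-s} · D_s^s`. -/
theorem statement_14 {E : Type*} [NormedAddCommGroup E] [InnerProductSpace ℝ E]
    (F₀ : Set E) (V : ℝ) (hV : 0 < V) (β : E → E → ℝ)
    (hβ : ∀ x ∈ F₀, ∀ y ∈ F₀, x ≠ y → 0 < β x y ∧ β x y ≤ V)
    (hD : setDiam F₀ ≠ ⊤)
    (q s : ℝ) (hq : 2 ≤ q) (hs2 : 2 ≤ s) (hsq : s ≤ q)
    (hDs : relSize F₀ V β s ≠ ⊤) :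
    relSize F₀ V β q ^ q ≤ setDiam F₀ ^ (q - s) * relSize F₀ V β s ^ s := by
  have hq0 : 0 < q := by linarith
  have hs0 : 0 < s := by linarith
  rw [← ENNReal.le_rpow_inv_iff hq0]
  unfold relSize
  refine iSup_le fun x => iSup_le fun hx => iSup_le fun y => iSup_le fun hy => iSup_le fun hxy => ?_
  rw [ENNReal.le_rpow_inv_iff hq0]
  have hb := hβ x hx y hy hxy
  have hn : 0 < ‖x - y‖ := norm_pos_iff.mpr (sub_ne_zero.mpr hxy)
  have hr : 0 ≤ V / β x y := (div_pos hV hb.1).le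
  have h1 : ENNReal.ofReal ‖x - y‖ ≤ setDiam F₀ :=
    le_iSup_of_le x (le_iSup_of_le hx (le_iSup_of_le y (le_iSup_of_le hy le_rfl)))
  have h2 : ENNReal.ofReal (‖x - y‖ * (V / β x y) ^ (1 / s)) ≤ relSize F₀ V β s :=
    le_iSup_of_le x (le_iSup_of_le hx (le_iSup_of_le y (le_iSup_of_le hy
      (le_iSup_of_le hxy le_rfl))))
  have key : ∀ t : ℝ, 0 < t → (‖x - y‖ * (V / β x y) ^ (1 / t)) ^ t
      = ‖x - y‖ ^ t * (V / β x y) := by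
    intro t ht
    rw [Real.mul_rpow hn.le (Real.rpow_nonneg hr _), ← Real.rpow_mul hr,
      one_div_mul_cancel ht.ne', Real.rpow_one]
  have e : ENNReal.ofReal (‖x - y‖ * (V / β x y) ^ (1 / q)) ^ q =
      ENNReal.ofReal ‖x - y‖ ^ (q - s) *
        ENNReal.ofReal (‖x - y‖ * (V / β x y) ^ (1 / s)) ^ s := by
    rw [ENNReal.ofReal_rpow_of_nonneg (by positivity) hq0.le,
      ENNReal.ofReal_rpow_of_nonneg (by positivity) hs0.le,
      ENNReal.ofReal_rpow_of_nonneg hn.le (by linarith),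
      ← ENNReal.ofReal_mul (by positivity), key q hq0, key s hs0, ← mul_assoc,
      ← Real.rpow_add hn, sub_add_cancel]
  rw [e]
  exact mul_le_mul' (ENNReal.rpow_le_rpow h1 (by linarith)) (ENNReal.rpow_le_rpow h2 hs0.le)
end

section
/- Let q ∈ [2, 4], s ∈ [2, ∞) with s ≠ q, M > 0, D_s > 0, V > 0; set γ := q(s − 1)/(s(q − 1)) and ω := (1/16) · (s/(s − 1))^γ · (V^{q/s}/(6M D_s^q))^{1/(q−1)}. Suppose F_k ≥ F_{k+1} > 0 and g_k, g_{k+1} > 0 satisfy F_k − F_{k+1} ≥ (1/(16(6M)^{1/(q−1)})) · (g_{k+1}/g_k)² · g_k^{q/(q−1)} and F_k ≤ ((s − 1)/s) · (D_s^s g_k^s / V)^{1/(s−1)}. Then (F_{k+1}^{1−γ} − F_k^{1−γ})/(γ − 1) ≥ ω · (g_{k+1}/g_k)². -/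
theorem aux_mvt (γ a b : ℝ) (hγ : 0 < γ) (h1 : γ ≠ 1) (hb : 0 < b) (hab : b ≤ a) :
    (a - b) * a ^ (-γ) ≤ (b ^ (1 - γ) - a ^ (1 - γ)) / (γ - 1) := by
  rcases hab.eq_or_lt with rfl | hlt
  · simp
  have hd : ∀ x : ℝ, 0 < x →
      HasDerivAt (fun x : ℝ => x ^ (1 - γ)) ((1 - γ) * x ^ (1 - γ - 1)) x :=
    fun x hx => Real.hasDerivAt_rpow_const (Or.inl hx.ne')
  obtain ⟨c, hc, he⟩ := exists_hasDerivAt_eq_slope (fun x : ℝ => x ^ (1 - γ))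
    (fun x => (1 - γ) * x ^ (1 - γ - 1)) hlt
    (fun x hx => (hd x (hb.trans_le hx.1)).continuousAt.continuousWithinAt)
    (fun x hx => hd x (hb.trans hx.1))
  have hg : γ - 1 ≠ 0 := sub_ne_zero.2 h1
  have hs : a - b ≠ 0 := (sub_pos.2 hlt).ne'
  have e : 1 - γ - 1 = -γ := by ring
  rw [eq_div_iff hs, e] at he
  have : (b ^ (1 - γ) - a ^ (1 - γ)) / (γ - 1) = (a - b) * c ^ (-γ) := by
    rw [div_eq_iff hg]; linear_combination he
  rw [this]
  exact mul_le_mul_of_nonneg_left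
    (Real.rpow_le_rpow_of_nonpos (hb.trans hc.1) hc.2.le (by linarith)) (by linarith)

theorem aux_id (q s M Ds V g γ : ℝ) (hq1 : 2 ≤ q) (hs : 2 ≤ s)
    (hM : 0 < M) (hDs : 0 < Ds) (hV : 0 < V) (hg : 0 < g)
    (hγ : γ = q * (s - 1) / (s * (q - 1))) :
    1 / 16 * (s / (s - 1)) ^ γ * (V ^ (q / s) / (6 * M * Ds ^ q)) ^ ((1 : ℝ) / (q - 1)) *
      ((s - 1) / s * (Ds ^ s * g ^ s / V) ^ ((1 : ℝ) / (s - 1))) ^ γ =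
    1 / (16 * (6 * M) ^ ((1 : ℝ) / (q - 1))) * g ^ (q / (q - 1)) := by
  have h1 : 0 < s - 1 := by linarith
  have h2 : 0 < q - 1 := by linarith
  have h3 : 0 < s := by linarith
  have h4 : 0 < 6 * M := by linarith
  have a1 := Real.rpow_pos_of_pos hDs s
  have a2 := Real.rpow_pos_of_pos hg s
  have a3 := Real.rpow_pos_of_pos hDs q
  have a4 := Real.rpow_pos_of_pos hV (q / s)
  have b1 : 0 < Ds ^ s * g ^ s / V := by positivity
  have b2 : 0 < V ^ (q / s) / (6 * M * Ds ^ q) := by positivity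
  have b3 : 0 < s / (s - 1) := by positivity
  have b4 : 0 < (s - 1) / s := by positivity
  have c1 := Real.rpow_pos_of_pos b1 ((1 : ℝ) / (s - 1))
  have c2 := Real.rpow_pos_of_pos b2 ((1 : ℝ) / (q - 1))
  have c3 := Real.rpow_pos_of_pos b3 γ
  have c4 := mul_pos b4 c1
  have c5 := Real.rpow_pos_of_pos c4 γ
  have c6 := Real.rpow_pos_of_pos h4 ((1 : ℝ) / (q - 1))
  have c7 := Real.rpow_pos_of_pos hg (q / (q - 1))
  apply Real.log_injOn_pos (Set.mem_Ioi.2 (by positivity)) (Set.mem_Ioi.2 (by positivity))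
  rw [Real.log_mul (by positivity) c5.ne', Real.log_mul (by positivity) c2.ne',
    Real.log_mul (by norm_num) c3.ne', Real.log_rpow b3, Real.log_rpow b2, Real.log_rpow c4,
    Real.log_mul b4.ne' c1.ne', Real.log_rpow b1, Real.log_div (mul_pos a1 a2).ne' hV.ne',
    Real.log_mul a1.ne' a2.ne', Real.log_rpow hDs, Real.log_rpow hg,
    Real.log_div a4.ne' (mul_pos h4 a3).ne', Real.log_rpow hV, Real.log_mul h4.ne' a3.ne',
    Real.log_rpow hDs, Real.log_div h3.ne' h1.ne', Real.log_div h1.ne' h3.ne',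
    Real.log_mul (by positivity) c7.ne', Real.log_rpow hg, one_div (16 * _), Real.log_inv,
    Real.log_mul (by norm_num) c6.ne', Real.log_rpow h4, one_div (16 : ℝ), Real.log_inv, hγ]
  field_simp
  ring

/-- (One-step estimate for strictly convex problems, in real-number form.)
Let `q ∈ [2,4]`, `s ∈ [2,∞)` with `s ≠ q`, `M > 0`, `D_s > 0`, `V > 0`; set
`γ := q(s-1)/(s(q-1))` and `ω := (1/16)(s/(s-1))^γ (V^{q/s}/(6M D_s^q))^{1/(q-1)}`.
If `F_k ≥ F_{k+1} > 0` and `g_k, g_{k+1} > 0` satisfy the per-iteration progress inequality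
and the uniform-convexity bound `F_k ≤ ((s-1)/s)(D_s^s g_k^s/V)^{1/(s-1)}`, then
`(F_{k+1}^{1-γ} - F_k^{1-γ})/(γ-1) ≥ ω (g_{k+1}/g_k)²`. -/
theorem statement_16 (q s M Ds V : ℝ) (hq1 : 2 ≤ q) (hq2 : q ≤ 4) (hs : 2 ≤ s)
    (hsq : s ≠ q) (hM : 0 < M) (hDs : 0 < Ds) (hV : 0 < V)
    (γ ω : ℝ) (hγ : γ = q * (s - 1) / (s * (q - 1)))
    (hω : ω = 1 / 16 * (s / (s - 1)) ^ γ *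
      (V ^ (q / s) / (6 * M * Ds ^ q)) ^ ((1 : ℝ) / (q - 1)))
    (Fk Fk1 gk gk1 : ℝ) (hmono : Fk1 ≤ Fk) (hFk1 : 0 < Fk1)
    (hgk : 0 < gk) (hgk1 : 0 < gk1)
    (hstep : Fk - Fk1 ≥
      1 / (16 * (6 * M) ^ ((1 : ℝ) / (q - 1))) * (gk1 / gk) ^ 2 * gk ^ (q / (q - 1)))
    (hconv : Fk ≤ (s - 1) / s * (Ds ^ s * gk ^ s / V) ^ ((1 : ℝ) / (s - 1))) :
    (Fk1 ^ (1 - γ) - Fk ^ (1 - γ)) / (γ - 1) ≥ ω * (gk1 / gk) ^ 2 := by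
  have h1 : 0 < s - 1 := by linarith
  have h2 : 0 < q - 1 := by linarith
  have h3 : 0 < s := by linarith
  have h5 : 0 < q := by linarith
  have hγ0 : 0 < γ := by rw [hγ]; positivity
  have hγ1 : γ ≠ 1 := by
    rw [hγ, Ne, div_eq_one_iff_eq (by positivity)]
    intro h
    exact hsq (by linarith)
  have hF : 0 < Fk := hFk1.trans_le hmono
  have key := aux_id q s M Ds V gk γ hq1 hs hM hDs hV hgk hγ
  rw [← hω] at key
  have hω0 : 0 ≤ ω := by rw [hω]; positivity
  have hp := Real.rpow_le_rpow hF.le hconv hγ0.le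
  have hFγ := Real.rpow_pos_of_pos hF γ
  have hk := mul_le_mul_of_nonneg_left hp hω0
  rw [key] at hk
  have hm := aux_mvt γ Fk Fk1 hγ0 hγ1 hFk1 hmono
  refine le_trans ?_ hm
  rw [Real.rpow_neg hF.le, ← div_eq_mul_inv, le_div_iff₀ hFγ]
  have := mul_le_mul_of_nonneg_right hk (sq_nonneg (gk1 / gk))
  linarith
end

section
/- Let q ∈ [2, 4], s > q, M > 0, D > 0, D_s > 0, V > 0, ε > 0, and k ≥ 1 an integer. Let F₀ ≥ F₁ ≥ … ≥ F_k > 0 and g₀, …, g_k > 0 satisfy, for every 0 ≤ i ≤ k − 1: F_i − F_{i+1} ≥ (1/(16(6M)^{1/(q−1)})) · (g_{i+1}/g_i)² · g_i^{q/(q−1)} and F_i ≤ ((s − 1)/s) · (D_s^s g_i^s / V)^{1/(s−1)}; moreover g_k ≥ F_k/D and F_i ≥ ε for all 0 ≤ i ≤ k. Then k ≤ 16 · ((s − 1)/s)^{q(s−1)/(s(q−1))} · (6M D_s^q / V^{q/s})^{1/(q−1)} · (s(q − 1)/(s − q)) · [ε^{−(s−q)/(s(q−1))} − F₀^{−(s−q)/(s(q−1))}]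 + 2 ln(g₀ D / ε). -/
lemma aux_pow (q s Ds V a F g : ℝ) (hq : 2 ≤ q) (hsq : q < s) (hDs : 0 < Ds) (hV : 0 < V)
    (ha : 0 < a) (hF : 0 < F) (hg : 0 < g)
    (h : F ≤ a * (Ds ^ s * g ^ s / V) ^ ((1 : ℝ) / (s - 1))) :
    F ^ (q * (s - 1) / (s * (q - 1))) ≤
      a ^ (q * (s - 1) / (s * (q - 1))) * (Ds ^ q / V ^ (q / s)) ^ ((1 : ℝ) / (q - 1))
        * g ^ (q / (q - 1)) := by
  have h1 : (0 : ℝ) < q - 1 := by linarith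
  have h2 : (0 : ℝ) < s - 1 := by linarith
  have h3 : (0 : ℝ) < s := by linarith
  have h4 := Real.log_le_log hF h
  have e1 : 0 < Ds ^ s := Real.rpow_pos_of_pos hDs _
  have e2 : 0 < g ^ s := Real.rpow_pos_of_pos hg _
  have e3 : 0 < Ds ^ q := Real.rpow_pos_of_pos hDs _
  have e4 : 0 < V ^ (q / s) := Real.rpow_pos_of_pos hV _
  have e5 : 0 < Ds ^ s * g ^ s / V := by positivity
  have e6 : 0 < Ds ^ q / V ^ (q / s) := by positivity
  rw [Real.log_mul ha.ne' (Real.rpow_pos_of_pos e5 _).ne', Real.log_rpow e5,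
    Real.log_div (by positivity) hV.ne', Real.log_mul e1.ne' e2.ne', Real.log_rpow hDs,
    Real.log_rpow hg] at h4
  have f1 := Real.rpow_pos_of_pos ha (q * (s - 1) / (s * (q - 1)))
  have f2 := Real.rpow_pos_of_pos e6 ((1 : ℝ) / (q - 1))
  have f3 := Real.rpow_pos_of_pos hg (q / (q - 1))
  rw [← Real.log_le_log_iff (Real.rpow_pos_of_pos hF _) (by positivity),
    Real.log_mul (by positivity) f3.ne', Real.log_mul f1.ne' f2.ne', Real.log_rpow hF,
    Real.log_rpow ha, Real.log_rpow e6, Real.log_rpow hg, Real.log_div e3.ne' e4.ne',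
    Real.log_rpow hDs, Real.log_rpow hV]
  have hp : 0 ≤ q * (s - 1) / (s * (q - 1)) := by positivity
  refine (mul_le_mul_of_nonneg_left h4 hp).trans (le_of_eq ?_)
  field_simp
  ring

lemma aux_bern (β x y : ℝ) (hβ : 0 < β) (hx : 0 < x) (hy : 0 < y) :
    β * (x - y) ≤ (y ^ (-β) - x ^ (-β)) * x ^ (1 + β) := by
  have ht : 0 < y / x := by positivity
  have h1 : 1 + β * (1 - y / x) ≤ (y / x) ^ (-β) := by
    rw [Real.rpow_def_of_pos ht]
    have := Real.add_one_le_exp (Real.log (y / x) * -β)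
    have h2 := Real.log_le_sub_one_of_pos ht
    nlinarith
  rw [Real.div_rpow hy.le hx.le] at h1
  have h3 : x ^ (-β) * x ^ (1 + β) = x := by
    rw [← Real.rpow_add hx]; simp
  have h4 := Real.rpow_pos_of_pos hx (-β)
  have h5 : y ^ (-β) * x ^ (1 + β) = x * (y ^ (-β) / x ^ (-β)) := by
    rw [eq_comm, mul_div_assoc', div_eq_iff h4.ne']
    linear_combination (-y ^ (-β)) * h3
  rw [sub_mul, h3, h5]
  have h6 := mul_le_mul_of_nonneg_left h1 hx.le
  have h7 : x * (1 + β * (1 - y / x)) = x + β * (x - y) := by field_simp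
  linarith

/-- (Global complexity on uniformly convex problems with `s > q`,
sequence form.) Let `q ∈ [2,4]`, `s > q`, `M, D, D_s, V, ε > 0`, `k ≥ 1`. If
`F₀ ≥ F₁ ≥ … ≥ F_k > 0` and `g₀, …, g_k > 0` satisfy, for `0 ≤ i ≤ k-1`, the progress
inequality and the uniform-convexity bound, and moreover `g_k ≥ F_k/D` and `F_i ≥ ε` for
`0 ≤ i ≤ k`, then
`k ≤ 16((s-1)/s)^{q(s-1)/(s(q-1))} (6M D_s^q/V^{q/s})^{1/(q-1)} (s(q-1)/(s-q))
  [ε^{-(s-q)/(s(q-1))} - F₀^{-(s-q)/(s(q-1))}] + 2 ln(g₀ D/ε)`. -/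
theorem statement_17 (q s M D Ds V ε : ℝ) (hq1 : 2 ≤ q) (hq2 : q ≤ 4) (hsq : q < s)
    (hM : 0 < M) (hD : 0 < D) (hDs : 0 < Ds) (hV : 0 < V) (hε : 0 < ε)
    (k : ℕ) (hk : 1 ≤ k) (F g : ℕ → ℝ)
    (hmono : ∀ i < k, F (i + 1) ≤ F i)
    (hFpos : ∀ i ≤ k, 0 < F i) (hgpos : ∀ i ≤ k, 0 < g i)
    (hstep : ∀ i < k,
      F i - F (i + 1) ≥
        1 / (16 * (6 * M) ^ ((1 : ℝ) / (q - 1))) * (g (i + 1) / g i) ^ 2 *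
          g i ^ (q / (q - 1)))
    (hconv : ∀ i < k,
      F i ≤ (s - 1) / s * (Ds ^ s * g i ^ s / V) ^ ((1 : ℝ) / (s - 1)))
    (hgk : g k ≥ F k / D)
    (heps : ∀ i ≤ k, F i ≥ ε) :
    (k : ℝ) ≤
      16 * ((s - 1) / s) ^ (q * (s - 1) / (s * (q - 1))) *
          (6 * M * Ds ^ q / V ^ (q / s)) ^ ((1 : ℝ) / (q - 1)) *
          (s * (q - 1) / (s - q)) *
          (ε ^ (-((s - q) / (s * (q - 1)))) - F 0 ^ (-((s - q) / (s * (q - 1))))) +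
        2 * Real.log (g 0 * D / ε) := by
  have h1 : (0 : ℝ) < q - 1 := by linarith
  have h2 : (0 : ℝ) < s - 1 := by linarith
  have h3 : (0 : ℝ) < s := by linarith
  have h4 : (0 : ℝ) < s - q := by linarith
  obtain ⟨β, hβd⟩ : ∃ β, β = (s - q) / (s * (q - 1)) := ⟨_, rfl⟩
  have hβ : 0 < β := by rw [hβd]; positivity
  have hp : q * (s - 1) / (s * (q - 1)) = 1 + β := by
    rw [hβd]; field_simp; ring
  have hinv : s * (q - 1) / (s - q) = 1 / β := by
    rw [hβd]; field_simp
  have ha : 0 < (s - 1) / s := by positivity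
  have hpow : ∀ i < k, _ := fun i hi =>
    aux_pow q s Ds V _ (F i) (g i) hq1 hsq hDs hV ha (hFpos i hi.le) (hgpos i hi.le) (hconv i hi)
  have e3 : 0 < Ds ^ q := Real.rpow_pos_of_pos hDs _
  have e4 : 0 < V ^ (q / s) := Real.rpow_pos_of_pos hV _
  have hsplit : (6 * M * Ds ^ q / V ^ (q / s)) ^ ((1 : ℝ) / (q - 1)) =
      (6 * M) ^ ((1 : ℝ) / (q - 1)) * (Ds ^ q / V ^ (q / s)) ^ ((1 : ℝ) / (q - 1)) := by
    rw [mul_div_assoc, Real.mul_rpow (by positivity) (by positivity)]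
  rw [hsplit, hinv, hp, ← hβd]
  simp only [hp] at hpow
  have hA : 0 < ((s - 1) / s) ^ (1 + β) := Real.rpow_pos_of_pos ha _
  have hB : 0 < (Ds ^ q / V ^ (q / s)) ^ ((1 : ℝ) / (q - 1)) :=
    Real.rpow_pos_of_pos (by positivity) _
  have hC : 0 < (6 * M) ^ ((1 : ℝ) / (q - 1)) := Real.rpow_pos_of_pos (by positivity) _
  generalize ((s - 1) / s) ^ (1 + β) = A at *
  generalize (Ds ^ q / V ^ (q / s)) ^ ((1 : ℝ) / (q - 1)) = B at *
  generalize (6 * M) ^ ((1 : ℝ) / (q - 1)) = C at *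
  have key : ∀ i < k, 1 + 2 * (Real.log (g (i + 1)) - Real.log (g i)) ≤
      16 * A * (C * B) * (1 / β) * (F (i + 1) ^ (-β) - F i ^ (-β)) := by
    intro i hi
    have hg0 := hgpos i hi.le
    have hg1 := hgpos (i + 1) hi
    have hF0 := hFpos i hi.le
    have hF1 := hFpos (i + 1) hi
    have hr : 1 + 2 * (Real.log (g (i + 1)) - Real.log (g i)) ≤ (g (i + 1) / g i) ^ 2 := by
      have := Real.log_le_sub_one_of_pos (show 0 < (g (i + 1) / g i) ^ 2 by positivity)
      rw [Real.log_pow, Real.log_div hg1.ne' hg0.ne'] at this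
      push_cast at this
      linarith
    refine hr.trans ?_
    have hb := aux_bern β (F i) (F (i + 1)) hβ hF0 hF1
    have hs := hstep i hi
    have hw := hpow i hi
    have hG : 0 < g i ^ (q / (q - 1)) := Real.rpow_pos_of_pos hg0 _
    have hP : 0 < F i ^ (1 + β) := Real.rpow_pos_of_pos hF0 _
    generalize g i ^ (q / (q - 1)) = G at *
    generalize F i ^ (1 + β) = P at *
    generalize F (i + 1) ^ (-β) - F i ^ (-β) = d at *
    have hr0 : 0 ≤ (g (i + 1) / g i) ^ 2 := by positivity
    generalize (g (i + 1) / g i) ^ 2 = r at *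
    have s1 : r * G ≤ 16 * C * (F i - F (i + 1)) := by
      have := mul_le_mul_of_nonneg_left hs (show 0 ≤ 16 * C by positivity)
      have e : 16 * C * (1 / (16 * C) * r * G) = r * G := by field_simp
      linarith
    have s2 : r * P ≤ 16 * A * (C * B) * (1 / β) * d * P := by
      calc r * P ≤ r * (A * B * G) := mul_le_mul_of_nonneg_left hw hr0
        _ = A * B * (r * G) := by ring
        _ ≤ A * B * (16 * C * (F i - F (i + 1))) :=
          mul_le_mul_of_nonneg_left s1 (by positivity)
        _ = 16 * A * (C * B) * (1 / β) * (β * (F i - F (i + 1))) := by field_simp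
        _ ≤ 16 * A * (C * B) * (1 / β) * (d * P) :=
          mul_le_mul_of_nonneg_left hb (by positivity)
        _ = _ := by ring
    exact le_of_mul_le_mul_right s2 hP
  have sum : ∀ n ≤ k, (n : ℝ) + 2 * (Real.log (g n) - Real.log (g 0)) ≤
      16 * A * (C * B) * (1 / β) * (F n ^ (-β) - F 0 ^ (-β)) := by
    intro n
    induction n with
    | zero => intro _; simp
    | succ n ih =>
      intro hn
      have := ih (by omega)
      have := key n (by omega)
      push_cast
      linarith
  have hfin := sum k le_rfl
  have hFk := Real.rpow_le_rpow_of_nonpos hε (heps k le_rfl) (show -β ≤ 0 by linarith)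
  have hm := mul_le_mul_of_nonneg_left (sub_le_sub_right hFk (F 0 ^ (-β)))
    (show 0 ≤ 16 * A * (C * B) * (1 / β) by positivity)
  have hl : Real.log ε - Real.log D ≤ Real.log (g k) := by
    rw [← Real.log_div hε.ne' hD.ne']
    apply Real.log_le_log (by positivity)
    exact (div_le_div_of_nonneg_right (heps k le_rfl) hD.le).trans hgk
  have hg0 := hgpos 0 (Nat.zero_le _)
  rw [Real.log_div (by positivity) hε.ne', Real.log_mul hg0.ne' hD.ne']
  linarith
end

section
/- Let Δ > 0, ζ > 0, and let (g_k)_{k≥0} be a sequence of nonnegative reals satisfying g_{k+1} ≤ Δ^{−ζ} · g_k^{1+ζ} for all k ≥ 0, with g₀ ≤ Δ/e. Then for any δ with 0 < δ ≤ Δ/e and any integer k ≥ ⌈ln ln(Δ/δ) / ln(1 + ζ)⌉, one has g_k ≤ δ. More precisely, g_k ≤ Δ · exp(−(1 + ζ)^k) for all k ≥ 0. -/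
/-- (Local superlinear convergence, sequence form.) Let `Δ > 0`, `ζ > 0`,
and let `(g_k)` be nonnegative reals with `g_{k+1} ≤ Δ^{-ζ} g_k^{1+ζ}` for all `k`, and
`g₀ ≤ Δ/e`. Then for any `0 < δ ≤ Δ/e` and any integer
`k ≥ ⌈ln ln(Δ/δ) / ln(1+ζ)⌉`, one has `g_k ≤ δ`. More precisely,
`g_k ≤ Δ · exp(-(1+ζ)^k)` for all `k ≥ 0`. -/
theorem statement_19 (Δ ζ : ℝ) (hΔ : 0 < Δ) (hζ : 0 < ζ)
    (g : ℕ → ℝ) (hg : ∀ k, 0 ≤ g k)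
    (hcontr : ∀ k : ℕ, g (k + 1) ≤ Δ ^ (-ζ) * g k ^ (1 + ζ))
    (h0 : g 0 ≤ Δ / Real.exp 1) :
    (∀ δ : ℝ, 0 < δ → δ ≤ Δ / Real.exp 1 →
        ∀ k : ℕ, ⌈Real.log (Real.log (Δ / δ)) / Real.log (1 + ζ)⌉ ≤ (k : ℤ) → g k ≤ δ) ∧
      ∀ k : ℕ, g k ≤ Δ * Real.exp (-(1 + ζ) ^ k) := by
  have main : ∀ k : ℕ, g k ≤ Δ * Real.exp (-(1 + ζ) ^ k) := by
    intro k
    induction k with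
    | zero =>
      rw [pow_zero, Real.exp_neg, ← div_eq_mul_inv]
      exact h0
    | succ k ih =>
      have h1 : g k ^ (1 + ζ) ≤ (Δ * Real.exp (-(1 + ζ) ^ k)) ^ (1 + ζ) :=
        Real.rpow_le_rpow (hg k) ih (by linarith)
      have h2 : 0 ≤ Δ ^ (-ζ) := Real.rpow_nonneg hΔ.le _
      have h3 : Δ ^ (-ζ) * Δ ^ (1 + ζ) = Δ := by
        rw [← Real.rpow_add hΔ]
        have : -ζ + (1 + ζ) = 1 := by ring
        rw [this, Real.rpow_one]
      calc g (k + 1) ≤ Δ ^ (-ζ) * g k ^ (1 + ζ) := hcontr k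
        _ ≤ Δ ^ (-ζ) * (Δ * Real.exp (-(1 + ζ) ^ k)) ^ (1 + ζ) :=
          mul_le_mul_of_nonneg_left h1 h2
        _ = Δ * Real.exp (-(1 + ζ) ^ (k + 1)) := by
          rw [Real.mul_rpow hΔ.le (Real.exp_pos _).le, ← mul_assoc, h3, ← Real.exp_mul,
            pow_succ, neg_mul]
  refine ⟨?_, main⟩
  intro δ hδ hδ2 k hk
  have hk' : Real.log (Real.log (Δ / δ)) / Real.log (1 + ζ) ≤ (k : ℝ) := by
    have := Int.ceil_le.mp hk
    exact_mod_cast this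
  have hl : 0 < Real.log (1 + ζ) := Real.log_pos (by linarith)
  rw [div_le_iff₀ hl] at hk'
  have hq : 0 < Δ / δ := div_pos hΔ hδ
  have he : Real.exp 1 ≤ Δ / δ := by
    rw [le_div_iff₀ (Real.exp_pos 1)] at hδ2
    rw [le_div_iff₀ hδ]
    linarith
  have hL : 1 ≤ Real.log (Δ / δ) := (Real.le_log_iff_exp_le hq).mpr he
  have hp : Real.log (Δ / δ) ≤ (1 + ζ) ^ k := by
    rw [← Real.log_pow] at hk'
    exact (Real.log_le_log_iff (by linarith) (by positivity)).mp hk'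
  calc g k ≤ Δ * Real.exp (-(1 + ζ) ^ k) := main k
    _ ≤ Δ * Real.exp (-Real.log (Δ / δ)) := by
      apply mul_le_mul_of_nonneg_left _ hΔ.le
      exact Real.exp_le_exp.mpr (neg_le_neg hp)
    _ = δ := by
      rw [Real.exp_neg, Real.exp_log hq]
      field_simp
end
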